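/- arXiv:1908.11419 — 2 statements merged into one kernel-verified Lean document; each statement's English description precedes it below -/
import Mathlib

section
/- Let W be a singular and asymmetric (i.e., not symmetric) discrete memoryless channel and ε ∈ (1/2,1) with V_ε(W) > 0. Then there exists a constant K̂(ε,W) > 0 such that for every blocklength N ∈ ℤ⁺, ln M*_c(N,ε) ≤ N·C(W) + √(N·V_ε(W))·Φ^{−1}(ε) + K̂(ε,W), where M*_c(N,ε) is the maximum number of messages achievable at blocklength N with average error probability at most ε by constant composition codes. -/
open Real Finset

variable {X Y : Type} [Fintype X] [Fintype Y]

/-- A discrete memoryless channel: `W x y` is the probability of output `y` given input `x`. -/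
def IsDMC (W : X → Y → ℝ) : Prop :=
  (∀ x y, 0 ≤ W x y) ∧ ∀ x, ∑ y, W x y = 1

/-- A probability distribution on a finite alphabet. -/
def IsProbDist (Q : X → ℝ) : Prop :=
  (∀ x, 0 ≤ Q x) ∧ ∑ x, Q x = 1

/-- Gallager symmetry: the output alphabet can be partitioned into classes such that within
each class every row is a permutation of every other row, and every column is a permutation
of every other column. -/
def GallagerSymmetric (W : X → Y → ℝ) : Prop :=
  ∃ cls : Y → ℕ,
    (∀ (l : ℕ) (x x' : X),
        ((Finset.univ.filter fun y => cls y = l).val.map fun y => W x y) =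
        ((Finset.univ.filter fun y => cls y = l).val.map fun y => W x' y)) ∧
    (∀ y y' : Y, cls y = cls y' →
        (Finset.univ.val.map fun x => W x y) = (Finset.univ.val.map fun x => W x y'))

/-- Singularity: whenever two inputs both give an output positive probability,
they give it the same probability. -/
def Singular (W : X → Y → ℝ) : Prop :=
  ∀ x z y, 0 < W x y * W z y → W x y = W z y

/-- Gallager's function `E_o(ρ, Q)`. -/
noncomputable def Eo (W : X → Y → ℝ) (Q : X → ℝ) (ρ : ℝ) : ℝ :=
  - Real.log (∑ y, (∑ x, Q x * W x y ^ (1 / (1 + ρ))) ^ (1 + ρ))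

/-- Mutual information `I(Q; W)`. -/
noncomputable def mutualInfo (W : X → Y → ℝ) (Q : X → ℝ) : ℝ :=
  ∑ x, ∑ y, Q x * W x y * Real.log (W x y / ∑ z, Q z * W z y)

/-- Channel capacity `C(W)`. -/
noncomputable def capacity (W : X → Y → ℝ) : ℝ :=
  sSup {r | ∃ Q, IsProbDist Q ∧ r = mutualInfo W Q}

/-- The set of values whose supremum is the sphere-packing exponent. -/
def ESPset (W : X → Y → ℝ) (R : ℝ) : Set ℝ :=
  {e | ∃ Q, IsProbDist Q ∧ ∃ ρ : ℝ, 0 ≤ ρ ∧ e = Eo W Q ρ - ρ * R}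

/-- The sphere-packing exponent `E_SP(R) = max_Q sup_{ρ ≥ 0} (E_o(ρ,Q) - ρ R)`. -/
noncomputable def ESP (W : X → Y → ℝ) (R : ℝ) : ℝ := sSup (ESPset W R)

/-- The random coding exponent `E_r(R) = max_Q max_{0 ≤ ρ ≤ 1} (E_o(ρ,Q) - ρ R)`. -/
noncomputable def Er (W : X → Y → ℝ) (R : ℝ) : ℝ :=
  sSup {e | ∃ Q, IsProbDist Q ∧ ∃ ρ : ℝ, 0 ≤ ρ ∧ ρ ≤ 1 ∧ e = Eo W Q ρ - ρ * R}

/-- `R_∞`: the supremum of rates at which the sphere-packing exponent is infinite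
(i.e. the defining supremum is unbounded). -/
noncomputable def Rinf (W : X → Y → ℝ) : ℝ :=
  sSup {R | ¬ BddAbove (ESPset W R)}

/-- The critical rate `R_cr`: the smallest rate above which `E_r = E_SP`. -/
noncomputable def Rcr (W : X → Y → ℝ) : ℝ :=
  sInf {R | ∀ R', R ≤ R' → Er W R' = ESP W R'}

/-- Number of messages of an `(N, R)` code: `⌈e^{NR}⌉`. -/
noncomputable def Mof (N : ℕ) (R : ℝ) : ℕ := ⌈Real.exp (N * R)⌉₊

/-- Error probability of message `m` for a (non-feedback) block code. -/
noncomputable def msgErrorProb (W : X → Y → ℝ) {N M : ℕ}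
    (f : Fin M → Fin N → X) (φ : (Fin N → Y) → Fin M) (m : Fin M) : ℝ :=
  ∑ y ∈ Finset.univ.filter (fun y : Fin N → Y => φ y ≠ m), ∏ n, W (f m n) (y n)

/-- Average error probability of a (non-feedback) block code. -/
noncomputable def avgErrorProb (W : X → Y → ℝ) {N M : ℕ}
    (f : Fin M → Fin N → X) (φ : (Fin N → Y) → Fin M) : ℝ :=
  (M : ℝ)⁻¹ * ∑ m, msgErrorProb W f φ m

/-- A feedback encoder, given as a function of the whole output word, is causal if the symbol
sent at time `n` depends only on the message and the outputs at times `< n`. -/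
def Causal {N M : ℕ} (f : Fin M → (Fin N → Y) → Fin N → X) : Prop :=
  ∀ m y y' n, (∀ k, k < n → y k = y' k) → f m y n = f m y' n

/-- Average error probability of a feedback code. -/
noncomputable def avgErrorProbFb (W : X → Y → ℝ) {N M : ℕ}
    (f : Fin M → (Fin N → Y) → Fin N → X) (φ : (Fin N → Y) → Fin M) : ℝ :=
  (M : ℝ)⁻¹ * ∑ m, ∑ y ∈ Finset.univ.filter (fun y : Fin N → Y => φ y ≠ m),
      ∏ n, W (f m y n) (y n)

/-- The (conditional information) dispersion `V(Q, W)`. -/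
noncomputable def Vdisp (W : X → Y → ℝ) (Q : X → ℝ) : ℝ :=
  ∑ x, ∑ y, Q x * W x y *
    (Real.log (W x y / ∑ z, Q z * W z y) -
      ∑ b, W x b * Real.log (W x b / ∑ z, Q z * W z b)) ^ 2

/-- The `ε`-dispersion `V_ε(W)`: the minimum (for `ε < 1/2`) or maximum (for `ε ≥ 1/2`) of
`V(Q,W)` over capacity-achieving input distributions `Q`. -/
noncomputable def Veps (W : X → Y → ℝ) (ε : ℝ) : ℝ :=
  if ε < 1 / 2 then
    sInf {v | ∃ Q, IsProbDist Q ∧ mutualInfo W Q = capacity W ∧ v = Vdisp W Q}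
  else
    sSup {v | ∃ Q, IsProbDist Q ∧ mutualInfo W Q = capacity W ∧ v = Vdisp W Q}

/-- The standard Gaussian cumulative distribution function `Φ`. -/
noncomputable def stdGaussCDF (x : ℝ) : ℝ :=
  (Real.sqrt (2 * Real.pi))⁻¹ * ∫ t in Set.Iic x, Real.exp (-t ^ 2 / 2)

/-- The inverse `Φ⁻¹` of the standard Gaussian CDF. -/
noncomputable def stdGaussInvCDF (p : ℝ) : ℝ := sInf {x | p ≤ stdGaussCDF x}

/-- A code is constant composition if all codewords have the same empirical distribution. -/
def ConstComp [DecidableEq X] {N M : ℕ} (f : Fin M → Fin N → X) : Prop :=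
  ∀ m m' x, (Finset.univ.filter fun n => f m n = x).card =
    (Finset.univ.filter fun n => f m' n = x).card

/-! ### Gaussian integrals and the solution of Stein's equation -/

lemma integrable_gauss : MeasureTheory.Integrable (fun x : ℝ => Real.exp (-x ^ 2 / 2)) := by
  refine (integrable_exp_neg_mul_sq (b := 1 / 2) (by norm_num)).congr (.of_forall fun x => ?_)
  dsimp only
  congr 1
  ring

lemma integral_gauss : ∫ x : ℝ, Real.exp (-x ^ 2 / 2) = Real.sqrt (2 * Real.pi) := by
  have h := integral_gaussian (1 / 2)
  rw [show Real.pi / (1 / 2) = 2 * Real.pi by ring] at h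
  rw [← h]
  congr 1
  ext x
  congr 1
  ring

lemma gauss_tail_le {w : ℝ} (hw : 0 ≤ w) :
    ∫ x in Set.Ioi w, Real.exp (-x ^ 2 / 2) ≤ Real.sqrt (2 * Real.pi) * Real.exp (-w ^ 2 / 2) := by
  have hi : MeasureTheory.Integrable
      (fun x : ℝ => Real.exp (-w ^ 2 / 2) * Real.exp (-(x - w) ^ 2 / 2)) :=
    (integrable_gauss.comp_sub_right w).const_mul _
  calc ∫ x in Set.Ioi w, Real.exp (-x ^ 2 / 2)
      ≤ ∫ x in Set.Ioi w, Real.exp (-w ^ 2 / 2) * Real.exp (-(x - w) ^ 2 / 2) := by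
        refine MeasureTheory.setIntegral_mono_on integrable_gauss.integrableOn hi.integrableOn
          measurableSet_Ioi fun x hx => ?_
        rw [← Real.exp_add]
        apply Real.exp_le_exp.2
        have := Set.mem_Ioi.1 hx
        nlinarith [mul_nonneg hw (sub_nonneg.2 this.le)]
    _ ≤ ∫ x : ℝ, Real.exp (-w ^ 2 / 2) * Real.exp (-(x - w) ^ 2 / 2) :=
        MeasureTheory.setIntegral_le_integral hi (.of_forall fun x => by positivity)
    _ = Real.sqrt (2 * Real.pi) * Real.exp (-w ^ 2 / 2) := by
        rw [MeasureTheory.integral_const_mul,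
          MeasureTheory.integral_sub_right_eq_self (fun x : ℝ => Real.exp (-x ^ 2 / 2)) w,
          integral_gauss, mul_comm]

lemma hasDerivAt_gauss (x : ℝ) :
    HasDerivAt (fun x : ℝ => Real.exp (-x ^ 2 / 2)) (-(x * Real.exp (-x ^ 2 / 2))) x := by
  have h : HasDerivAt (fun x : ℝ => -x ^ 2 / 2) (-x) x := by
    refine (((hasDerivAt_pow 2 x).neg).div_const 2).congr_deriv ?_
    norm_num
    ring
  exact h.exp.congr_deriv (by ring)

lemma mul_gauss_tail_le (w : ℝ) :
    w * ∫ x in Set.Ioi w, Real.exp (-x ^ 2 / 2) ≤ Real.exp (-w ^ 2 / 2) := by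
  have hi : MeasureTheory.Integrable (fun x : ℝ => x * Real.exp (-x ^ 2 / 2)) := by
    refine (integrable_mul_exp_neg_mul_sq (b := 1 / 2) (by norm_num)).congr
      (.of_forall fun x => ?_)
    dsimp only
    congr 2
    ring
  have hlim : Filter.Tendsto (fun x : ℝ => -Real.exp (-x ^ 2 / 2)) Filter.atTop (nhds (-0)) := by
    refine (Real.tendsto_exp_atBot.comp ?_).neg
    have := Filter.tendsto_neg_atTop_atBot.comp
      ((Filter.tendsto_pow_atTop (α := ℝ) (n := 2) (by norm_num)).atTop_div_const
        (show (0 : ℝ) < 2 by norm_num))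
    refine this.congr fun x => ?_
    simp only [Function.comp]
    ring
  have hftc := MeasureTheory.integral_Ioi_of_hasDerivAt_of_tendsto (a := w)
    (f := fun x : ℝ => -Real.exp (-x ^ 2 / 2)) (f' := fun x => x * Real.exp (-x ^ 2 / 2))
    (by fun_prop) (fun x _ => ((hasDerivAt_gauss x).neg).congr_deriv (neg_neg _))
    hi.integrableOn hlim
  rw [← MeasureTheory.integral_const_mul]
  calc ∫ x in Set.Ioi w, w * Real.exp (-x ^ 2 / 2)
      ≤ ∫ x in Set.Ioi w, x * Real.exp (-x ^ 2 / 2) := by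
        refine MeasureTheory.setIntegral_mono_on (integrable_gauss.const_mul w).integrableOn
          hi.integrableOn measurableSet_Ioi fun x hx => ?_
        have := Set.mem_Ioi.1 hx
        gcongr
    _ = Real.exp (-w ^ 2 / 2) := by rw [hftc]; ring

/-- The expectation of a function under the standard Gaussian law. -/
noncomputable def gaussMean (h : ℝ → ℝ) : ℝ :=
  (Real.sqrt (2 * Real.pi))⁻¹ * ∫ x, h x * Real.exp (-x ^ 2 / 2)

lemma integrable_mul_gauss {h : ℝ → ℝ} (hc : Continuous h) {b : ℝ} (hb : ∀ x, |h x| ≤ b) :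
    MeasureTheory.Integrable (fun x : ℝ => h x * Real.exp (-x ^ 2 / 2)) :=
  integrable_gauss.bdd_mul hc.aestronglyMeasurable (.of_forall hb)

lemma gaussMean_mem_Icc {h : ℝ → ℝ} (hc : Continuous h) (h0 : ∀ x, 0 ≤ h x) (h1 : ∀ x, h x ≤ 1) :
    0 ≤ gaussMean h ∧ gaussMean h ≤ 1 := by
  have hZ : 0 < Real.sqrt (2 * Real.pi) := by positivity
  refine ⟨mul_nonneg (by positivity) (MeasureTheory.integral_nonneg fun x =>
    mul_nonneg (h0 x) (Real.exp_pos _).le), ?_⟩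
  rw [gaussMean, inv_mul_le_iff₀ hZ, mul_one, ← integral_gauss]
  refine MeasureTheory.integral_mono (integrable_mul_gauss hc (b := 1) fun x => ?_)
    integrable_gauss fun x => ?_
  · rw [abs_of_nonneg (h0 x)]; exact h1 x
  · exact mul_le_of_le_one_left (Real.exp_pos _).le (h1 x)

/-- Stein's equation for a bounded continuous test function has a bounded solution. -/
lemma exists_stein_solution {h : ℝ → ℝ} (hc : Continuous h) (h0 : ∀ x, 0 ≤ h x)
    (h1 : ∀ x, h x ≤ 1) :
    ∃ f : ℝ → ℝ, (∀ w, HasDerivAt f (w * f w + (h w - gaussMean h)) w) ∧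
      (∀ w, |f w| ≤ Real.sqrt (2 * Real.pi)) ∧ ∀ w, |w * f w| ≤ 1 := by
  obtain ⟨hm0, hm1⟩ := gaussMean_mem_Icc hc h0 h1
  set g : ℝ → ℝ := fun x => h x - gaussMean h with hg
  have hgc : Continuous g := by fun_prop
  have hgb : ∀ x, |g x| ≤ 1 := fun x => by
    rw [abs_le]; constructor <;> simp only [hg] <;> linarith [h0 x, h1 x]
  have hZ : 0 < Real.sqrt (2 * Real.pi) := by positivity
  set k : ℝ → ℝ := fun x => g x * Real.exp (-x ^ 2 / 2) with hk
  have hkc : Continuous k := by fun_prop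
  have hki : MeasureTheory.Integrable k := integrable_mul_gauss hgc hgb
  have hk_abs : ∀ x, |k x| ≤ Real.exp (-x ^ 2 / 2) := fun x => by
    simp only [hk, abs_mul, abs_of_pos (Real.exp_pos _)]
    exact mul_le_of_le_one_left (Real.exp_pos _).le (hgb x)
  have hk0 : ∫ x, k x = 0 := by
    simp only [hk, hg, sub_mul]
    rw [MeasureTheory.integral_sub (integrable_mul_gauss hc (b := 1) fun x => by
      rw [abs_of_nonneg (h0 x)]; exact h1 x) (integrable_gauss.const_mul _),
      MeasureTheory.integral_const_mul, integral_gauss, gaussMean]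
    field_simp
    ring
  set F : ℝ → ℝ := fun w => ∫ x in Set.Iic w, k x with hF
  have hFd : ∀ w, HasDerivAt F (k w) w := fun w => by
    have h := intervalIntegral.integral_hasDerivAt_right (f := k) (a := 0) (b := w)
      (hkc.intervalIntegrable _ _) (hkc.stronglyMeasurableAtFilter _ _) hkc.continuousAt
    refine (h.const_add (F 0)).congr_of_eventuallyEq (.of_forall fun u => ?_)
    simp only [hF]
    rw [← intervalIntegral.integral_Iic_sub_Iic hki.integrableOn hki.integrableOn]
    ring
  have hFb : ∀ w, |F w| ≤ ∫ x in Set.Ioi |w|, Real.exp (-x ^ 2 / 2) := fun w => by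
    rcases le_total 0 w with hw | hw
    · have : F w = -∫ x in Set.Ioi w, k x := by
        have := intervalIntegral.integral_Iic_add_Ioi (b := w) hki.integrableOn hki.integrableOn
        simp only [hF]
        linarith
      rw [this, abs_neg, abs_of_nonneg hw]
      refine (MeasureTheory.abs_integral_le_integral_abs).trans ?_
      exact MeasureTheory.setIntegral_mono_on hki.abs.integrableOn integrable_gauss.integrableOn
        measurableSet_Ioi fun x _ => hk_abs x
    · rw [abs_of_nonpos hw, ← integral_comp_neg_Iic]
      simp only [neg_sq]
      refine (MeasureTheory.abs_integral_le_integral_abs).trans ?_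
      exact MeasureTheory.setIntegral_mono_on hki.abs.integrableOn integrable_gauss.integrableOn
        measurableSet_Iic fun x _ => hk_abs x
  have hee : ∀ w : ℝ, Real.exp (w ^ 2 / 2) * Real.exp (-w ^ 2 / 2) = 1 := fun w => by
    rw [← Real.exp_add, ← Real.exp_zero]; congr 1; ring
  refine ⟨fun w => Real.exp (w ^ 2 / 2) * F w, fun w => ?_, fun w => ?_, fun w => ?_⟩
  · have hd : HasDerivAt (fun w : ℝ => Real.exp (w ^ 2 / 2)) (w * Real.exp (w ^ 2 / 2)) w := by
      have h : HasDerivAt (fun x : ℝ => x ^ 2 / 2) w w := by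
        refine ((hasDerivAt_pow 2 w).div_const 2).congr_deriv ?_
        norm_num
      exact h.exp.congr_deriv (by ring)
    refine (hd.mul (hFd w)).congr_deriv ?_
    have : Real.exp (w ^ 2 / 2) * k w = g w := by
      simp only [hk]
      rw [mul_left_comm, hee, mul_one]
    rw [this]
    ring
  · rw [abs_mul, abs_of_pos (Real.exp_pos _)]
    calc Real.exp (w ^ 2 / 2) * |F w|
        ≤ Real.exp (w ^ 2 / 2) * (Real.sqrt (2 * Real.pi) * Real.exp (-|w| ^ 2 / 2)) := by
          gcongr
          exact (hFb w).trans (gauss_tail_le (abs_nonneg w))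
      _ = Real.sqrt (2 * Real.pi) := by rw [sq_abs, mul_left_comm, hee, mul_one]
  · rw [mul_left_comm, abs_mul, abs_of_pos (Real.exp_pos _), abs_mul]
    calc Real.exp (w ^ 2 / 2) * (|w| * |F w|)
        ≤ Real.exp (w ^ 2 / 2) * Real.exp (-|w| ^ 2 / 2) := by
          gcongr
          exact (mul_le_mul_of_nonneg_left (hFb w) (abs_nonneg w)).trans
            (mul_gauss_tail_le |w|)
      _ = 1 := by rw [sq_abs, hee]

/-! ### The Gaussian distribution function -/

lemma stdGaussCDF_mono : Monotone stdGaussCDF := fun a b hab => by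
  refine mul_le_mul_of_nonneg_left ?_ (by positivity)
  exact MeasureTheory.setIntegral_mono_set integrable_gauss.integrableOn
    (.of_forall fun x => (Real.exp_pos _).le) (Set.Iic_subset_Iic.2 hab).eventuallyLE

lemma stdGaussCDF_sub (a b : ℝ) : stdGaussCDF b - stdGaussCDF a =
    (Real.sqrt (2 * Real.pi))⁻¹ * ∫ t in a..b, Real.exp (-t ^ 2 / 2) := by
  rw [stdGaussCDF, stdGaussCDF, ← mul_sub,
    intervalIntegral.integral_Iic_sub_Iic integrable_gauss.integrableOn
      integrable_gauss.integrableOn]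

lemma one_sub_stdGaussCDF (z : ℝ) : 1 - stdGaussCDF z =
    (Real.sqrt (2 * Real.pi))⁻¹ * ∫ t in Set.Ioi z, Real.exp (-t ^ 2 / 2) := by
  have h := intervalIntegral.integral_Iic_add_Ioi (b := z)
    integrable_gauss.integrableOn integrable_gauss.integrableOn
  rw [integral_gauss] at h
  have hZ : 0 < Real.sqrt (2 * Real.pi) := by positivity
  rw [stdGaussCDF, eq_sub_of_add_eq' h, mul_sub, inv_mul_cancel₀ hZ.ne']

lemma stdGaussCDF_zero : stdGaussCDF 0 = 1 / 2 := by
  have h := one_sub_stdGaussCDF 0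
  have h2 := integral_comp_neg_Iic (0 : ℝ) (fun t : ℝ => Real.exp (-t ^ 2 / 2))
  simp only [neg_sq, neg_zero] at h2
  rw [← h2] at h
  have h3 : 1 - stdGaussCDF 0 = stdGaussCDF 0 := h
  linarith

lemma tendsto_stdGaussCDF_atTop : Filter.Tendsto stdGaussCDF Filter.atTop (nhds 1) := by
  have h := ((MeasureTheory.aecover_Iic Filter.tendsto_id).integral_tendsto_of_countably_generated
    integrable_gauss).const_mul (Real.sqrt (2 * Real.pi))⁻¹
  rw [integral_gauss, inv_mul_cancel₀ (by positivity)] at h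
  exact h

lemma continuous_stdGaussCDF : Continuous stdGaussCDF := by
  have h : stdGaussCDF = fun b => stdGaussCDF 0 +
      (Real.sqrt (2 * Real.pi))⁻¹ * ∫ t in (0 : ℝ)..b, Real.exp (-t ^ 2 / 2) := by
    ext b
    linarith [stdGaussCDF_sub 0 b]
  rw [h]
  exact continuous_const.add (continuous_const.mul
    (intervalIntegral.continuous_primitive (fun a b => by
      exact integrable_gauss.intervalIntegrable) 0))

lemma le_stdGaussCDF_stdGaussInvCDF {ε : ℝ} (h0 : 1 / 2 < ε) (h1 : ε < 1) :
    0 ≤ stdGaussInvCDF ε ∧ ε ≤ stdGaussCDF (stdGaussInvCDF ε) := by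
  have hpos : ∀ x ∈ {x | ε ≤ stdGaussCDF x}, 0 ≤ x := fun x hx => by
    by_contra! hneg
    have := stdGaussCDF_mono hneg.le
    rw [stdGaussCDF_zero] at this
    have : ε ≤ stdGaussCDF x := hx
    linarith
  have hne : {x | ε ≤ stdGaussCDF x}.Nonempty :=
    (tendsto_stdGaussCDF_atTop.eventually (eventually_ge_nhds h1)).exists
  refine ⟨le_csInf hne hpos, ?_⟩
  exact (isClosed_le continuous_const continuous_stdGaussCDF).csInf_mem hne ⟨0, hpos⟩

/-- A linear lower bound on the growth of the Gaussian distribution function. -/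
lemma stdGaussCDF_add_ge {z t : ℝ} (hz : 0 ≤ z) (ht : 0 ≤ t) (ht1 : t ≤ 1) :
    stdGaussCDF z + t * ((Real.sqrt (2 * Real.pi))⁻¹ * Real.exp (-(z + 1) ^ 2 / 2)) ≤
      stdGaussCDF (z + t) := by
  have h := stdGaussCDF_sub z (z + t)
  have h2 : t * Real.exp (-(z + 1) ^ 2 / 2) ≤ ∫ x in z..(z + t), Real.exp (-x ^ 2 / 2) := by
    have h3 : ∫ x in z..(z + t), Real.exp (-(z + 1) ^ 2 / 2) ≤
        ∫ x in z..(z + t), Real.exp (-x ^ 2 / 2) := by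
      refine intervalIntegral.integral_mono_on (by linarith) (by simp)
        integrable_gauss.intervalIntegrable fun x hx => ?_
      apply Real.exp_le_exp.2
      have : x ≤ z + 1 := by linarith [hx.2]
      nlinarith [hx.1]
    simpa using h3
  have := mul_le_mul_of_nonneg_left h2 (show 0 ≤ (Real.sqrt (2 * Real.pi))⁻¹ by positivity)
  linarith

/-- The ramp function that rises from `0` at `z` to `1` at `z + δ`. -/
noncomputable def ramp (z δ x : ℝ) : ℝ := max 0 (min 1 ((x - z) / δ))

lemma ramp_nonneg (z δ x : ℝ) : 0 ≤ ramp z δ x := le_max_left _ _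

lemma ramp_le_one (z δ x : ℝ) : ramp z δ x ≤ 1 := max_le zero_le_one (min_le_left _ _)

lemma continuous_ramp (z δ : ℝ) : Continuous (ramp z δ) := by
  unfold ramp
  fun_prop

lemma ramp_eq_zero {z δ x : ℝ} (hδ : 0 < δ) (hx : x ≤ z) : ramp z δ x = 0 :=
  max_eq_left ((min_le_right _ _).trans (div_nonpos_of_nonpos_of_nonneg (by linarith) hδ.le))

lemma ramp_eq_one {z δ x : ℝ} (hδ : 0 < δ) (hx : z + δ ≤ x) : ramp z δ x = 1 := by
  have : 1 ≤ (x - z) / δ := by rw [le_div_iff₀ hδ]; linarith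
  rw [ramp, min_eq_left this, max_eq_right zero_le_one]

lemma gaussMean_ramp_le {z δ : ℝ} (hδ : 0 < δ) : gaussMean (ramp z δ) ≤ 1 - stdGaussCDF z := by
  rw [one_sub_stdGaussCDF, gaussMean]
  refine mul_le_mul_of_nonneg_left ?_ (by positivity)
  rw [← MeasureTheory.integral_indicator measurableSet_Ioi]
  refine MeasureTheory.integral_mono (integrable_mul_gauss (continuous_ramp z δ) (b := 1)
    fun x => ?_)
    (integrable_gauss.indicator measurableSet_Ioi) fun x => ?_
  · rw [abs_of_nonneg (ramp_nonneg _ _ _)]; exact ramp_le_one _ _ _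
  · dsimp only
    by_cases hx : x ∈ Set.Ioi z
    · rw [Set.indicator_of_mem hx]
      exact mul_le_of_le_one_left (Real.exp_pos _).le (ramp_le_one _ _ _)
    · rw [Set.indicator_of_notMem hx, ramp_eq_zero hδ (not_lt.1 hx), zero_mul]

/-! ### Expectations under finite product laws -/

section ProductLaw

variable {ι β : Type} [Fintype ι] [DecidableEq ι] [Fintype β]

/-- The expectation of `F` when the coordinates are independent with laws `w i`. -/
noncomputable def prodMean (w : ι → β → ℝ) (F : (ι → β) → ℝ) : ℝ :=
  ∑ y, (∏ n, w n (y n)) * F y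

/-- A family of probability weights. -/
def IsLaw (w : ι → β → ℝ) : Prop := ∀ n, (∀ b, 0 ≤ w n b) ∧ ∑ b, w n b = 1

lemma prodMean_mono {w : ι → β → ℝ} (hw : IsLaw w) {F G : (ι → β) → ℝ} (h : ∀ y, F y ≤ G y) :
    prodMean w F ≤ prodMean w G :=
  Finset.sum_le_sum fun y _ =>
    mul_le_mul_of_nonneg_left (h y) (Finset.prod_nonneg fun n _ => (hw n).1 _)

lemma prodMean_add (w : ι → β → ℝ) (F G : (ι → β) → ℝ) :
    prodMean w (fun y => F y + G y) = prodMean w F + prodMean w G := by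
  simp only [prodMean, mul_add, Finset.sum_add_distrib]

lemma prodMean_sub (w : ι → β → ℝ) (F G : (ι → β) → ℝ) :
    prodMean w (fun y => F y - G y) = prodMean w F - prodMean w G := by
  simp only [prodMean, mul_sub, Finset.sum_sub_distrib]

lemma prodMean_mul_left (w : ι → β → ℝ) (c : ℝ) (F : (ι → β) → ℝ) :
    prodMean w (fun y => c * F y) = c * prodMean w F := by
  simp only [prodMean, Finset.mul_sum]
  exact Finset.sum_congr rfl fun y _ => by ring

lemma prodMean_sum {κ : Type} (s : Finset κ) (w : ι → β → ℝ) (F : κ → (ι → β) → ℝ) :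
    prodMean w (fun y => ∑ k ∈ s, F k y) = ∑ k ∈ s, prodMean w (F k) := by
  simp only [prodMean, Finset.mul_sum]
  exact Finset.sum_comm

lemma prodMean_const {w : ι → β → ℝ} (hw : IsLaw w) (c : ℝ) :
    prodMean w (fun _ => c) = c := by
  rw [prodMean, ← Finset.sum_mul, ← Fintype.piFinset_univ, ← Finset.prod_univ_sum]
  simp [(hw _).2]

lemma abs_prodMean_le {w : ι → β → ℝ} (hw : IsLaw w) (F : (ι → β) → ℝ) :
    |prodMean w F| ≤ prodMean w fun y => |F y| := by
  refine (Finset.abs_sum_le_sum_abs _ _).trans (Finset.sum_le_sum fun y _ => ?_)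
  rw [abs_mul, abs_of_nonneg (Finset.prod_nonneg fun n _ => (hw n).1 _)]

/-- Resampling one coordinate does not change an expectation. -/
lemma prodMean_resample {w : ι → β → ℝ} (hw : IsLaw w) (i : ι) (F : (ι → β) → ℝ) :
    prodMean w (fun y => ∑ b, w i b * F (Function.update y i b)) = prodMean w F := by
  let e : (ι → β) × β → (ι → β) × β := fun p => (Function.update p.1 i p.2, p.1 i)
  have he : Function.Involutive e := fun p => by simp [e]
  have hprod : ∀ (y : ι → β) (b : β), (∏ n, w n (Function.update y i b n)) * w i (y i) =
      (∏ n, w n (y n)) * w i b := fun y b => by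
    rw [← Finset.mul_prod_erase univ _ (mem_univ i),
      ← Finset.mul_prod_erase univ (fun n => w n (y n)) (mem_univ i)]
    have : ∏ n ∈ univ.erase i, w n (Function.update y i b n) = ∏ n ∈ univ.erase i, w n (y n) :=
      Finset.prod_congr rfl fun n hn => by
        rw [Function.update_of_ne (Finset.ne_of_mem_erase hn)]
    rw [this, Function.update_self]
    ring
  have h1 : prodMean w (fun y => ∑ b, w i b * F (Function.update y i b)) =
      ∑ p : (ι → β) × β, (∏ n, w n (p.1 n)) * w i p.2 * F (e p).1 := by
    rw [Fintype.sum_prod_type]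
    simp only [prodMean, Finset.mul_sum, e, mul_assoc]
  have h2 : prodMean w F = ∑ p : (ι → β) × β, (∏ n, w n (p.1 n)) * w i p.2 * F p.1 := by
    rw [Fintype.sum_prod_type]
    refine Finset.sum_congr rfl fun y _ => ?_
    dsimp only
    rw [← Finset.sum_mul, ← Finset.mul_sum, (hw i).2, mul_one]
  rw [h1, h2, ← Equiv.sum_comp he.toPerm]
  refine Finset.sum_congr rfl fun p _ => ?_
  rw [Function.Involutive.coe_toPerm, he p]
  exact congrArg (· * F p.1) (hprod p.1 p.2)

/-- The data of independent, centred and bounded summands. -/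
structure CentredSum (w ξ : ι → β → ℝ) (δ : ℝ) : Prop where
  law : IsLaw w
  mean : ∀ n, ∑ b, w n b * ξ n b = 0
  bound : ∀ n b, |ξ n b| ≤ δ

/-- The total variance of independent centred summands. -/
noncomputable def sumVar (w ξ : ι → β → ℝ) : ℝ := ∑ n, ∑ b, w n b * ξ n b ^ 2

omit [Fintype β] in
lemma sum_update (ξ : ι → β → ℝ) (y : ι → β) (i : ι) (b : β) :
    ∑ n, ξ n (Function.update y i b n) = ∑ n, ξ n (y n) - ξ i (y i) + ξ i b := by
  rw [← Finset.add_sum_erase univ _ (mem_univ i),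
    ← Finset.add_sum_erase univ (fun n => ξ n (y n)) (mem_univ i), Function.update_self]
  have : ∑ n ∈ univ.erase i, ξ n (Function.update y i b n) = ∑ n ∈ univ.erase i, ξ n (y n) :=
    Finset.sum_congr rfl fun n hn => by rw [Function.update_of_ne (Finset.ne_of_mem_erase hn)]
  rw [this]
  ring

variable {w ξ : ι → β → ℝ} {δ : ℝ}

/-- Leave-one-out formula for the covariance of a sum with a function of it. -/
lemma CentredSum.mean_mul_eq (H : CentredSum w ξ δ) (f : ℝ → ℝ) :
    prodMean w (fun y => (∑ n, ξ n (y n)) * f (∑ n, ξ n (y n))) =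
      ∑ i, prodMean w (fun y => ∑ b, w i b * (ξ i b *
        (f (∑ n, ξ n (y n) - ξ i (y i) + ξ i b) - f (∑ n, ξ n (y n) - ξ i (y i))))) := by
  simp only [Finset.sum_mul]
  rw [prodMean_sum]
  refine Finset.sum_congr rfl fun i _ => ?_
  rw [← prodMean_resample H.law i]
  congr 1
  ext y
  simp only [sum_update, Function.update_self, mul_sub, Finset.sum_sub_distrib]
  simp only [← mul_assoc, ← Finset.sum_mul, H.mean, zero_mul, sub_zero]

/-- Approximate Stein identity. -/
lemma CentredSum.stein (H : CentredSum w ξ δ) {f f' R : ℝ → ℝ}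
    (hf : ∀ x, HasDerivAt f (f' x) x) (hR : ∀ x t, |t| ≤ 2 * δ → |f' (x + t) - f' x| ≤ R x) :
    |prodMean w (fun y => (∑ n, ξ n (y n)) * f (∑ n, ξ n (y n))) -
      sumVar w ξ * prodMean w (fun y => f' (∑ n, ξ n (y n)))| ≤
      sumVar w ξ * prodMean w (fun y => R (∑ n, ξ n (y n))) := by
  rw [H.mean_mul_eq, sumVar, Finset.sum_mul, Finset.sum_mul, ← Finset.sum_sub_distrib]
  refine (Finset.abs_sum_le_sum_abs _ _).trans (Finset.sum_le_sum fun i _ => ?_)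
  rw [← prodMean_mul_left, ← prodMean_mul_left, ← prodMean_sub]
  refine (abs_prodMean_le H.law _).trans (prodMean_mono H.law fun y => ?_)
  rw [Finset.sum_mul, Finset.sum_mul, ← Finset.sum_sub_distrib]
  refine (Finset.abs_sum_le_sum_abs _ _).trans (Finset.sum_le_sum fun b _ => ?_)
  set s := ∑ n, ξ n (y n)
  set c := s - ξ i (y i) with hc
  have hwb := (H.law i).1 b
  have key : |ξ i b * (f (c + ξ i b) - f c) - ξ i b ^ 2 * f' s| ≤ ξ i b ^ 2 * R s := by
    obtain ⟨θ, hθ, hθe⟩ : ∃ θ, |θ| ≤ |ξ i b| ∧ f (c + ξ i b) - f c = ξ i b * f' (c + θ) := by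
      rcases lt_trichotomy (ξ i b) 0 with h | h | h
      · obtain ⟨m, hm, hme⟩ := exists_hasDerivAt_eq_slope f f' (show c + ξ i b < c by linarith)
          (fun x _ => (hf x).continuousAt.continuousWithinAt) fun x _ => hf x
        refine ⟨m - c, ?_, ?_⟩
        · rw [abs_of_neg h, abs_of_neg (by linarith [hm.2])]
          linarith [hm.1]
        · have hne : ξ i b ≠ 0 := h.ne
          rw [add_sub_cancel, hme, show c - (c + ξ i b) = -ξ i b by ring]
          field_simp
          ring
      · exact ⟨0, by simp, by simp [h]⟩
      · obtain ⟨m, hm, hme⟩ := exists_hasDerivAt_eq_slope f f' (show c < c + ξ i b by linarith)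
          (fun x _ => (hf x).continuousAt.continuousWithinAt) fun x _ => hf x
        refine ⟨m - c, ?_, ?_⟩
        · rw [abs_of_pos h, abs_of_pos (by linarith [hm.1])]
          linarith [hm.2]
        · rw [add_sub_cancel, hme, add_sub_cancel_left, mul_div_cancel₀ _ h.ne']
    rw [hθe, show ξ i b * (ξ i b * f' (c + θ)) - ξ i b ^ 2 * f' s =
      ξ i b ^ 2 * (f' (s + (θ - ξ i (y i))) - f' s) by rw [hc]; ring_nf, abs_mul,
      abs_of_nonneg (sq_nonneg _)]
    refine mul_le_mul_of_nonneg_left (hR _ _ ?_) (sq_nonneg _)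
    calc |θ - ξ i (y i)| ≤ |θ| + |ξ i (y i)| := abs_sub _ _
      _ ≤ 2 * δ := by linarith [H.bound i b, H.bound i (y i)]
  calc |w i b * (ξ i b * (f (c + ξ i b) - f c)) - w i b * ξ i b ^ 2 * f' s|
      = w i b * |ξ i b * (f (c + ξ i b) - f c) - ξ i b ^ 2 * f' s| := by
        rw [← abs_of_nonneg hwb, ← abs_mul, abs_of_nonneg hwb]; ring_nf
    _ ≤ w i b * (ξ i b ^ 2 * R s) := by gcongr
    _ = w i b * ξ i b ^ 2 * R s := by ring

lemma CentredSum.mean_sq (H : CentredSum w ξ δ) :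
    prodMean w (fun y => (∑ n, ξ n (y n)) ^ 2) = sumVar w ξ := by
  have h := H.stein (f := fun x => x) (f' := fun _ => 1) (R := fun _ => 0) hasDerivAt_id
    (by simp)
  rw [prodMean_const H.law, prodMean_const H.law, mul_zero, mul_one, abs_nonpos_iff] at h
  simp only [sq]
  linarith

lemma CentredSum.mean_abs_le (H : CentredSum w ξ δ) {σ : ℝ} (hσ : 0 < σ)
    (hv : sumVar w ξ = σ ^ 2) : prodMean w (fun y => |∑ n, ξ n (y n)|) ≤ σ := by
  have h : prodMean w (fun y => |∑ n, ξ n (y n)|) ≤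
      prodMean w (fun y => σ / 2 + (2 * σ)⁻¹ * (∑ n, ξ n (y n)) ^ 2) := by
    refine prodMean_mono H.law fun y => ?_
    rw [← sq_abs, ← sub_nonneg]
    have : σ / 2 + (2 * σ)⁻¹ * |∑ n, ξ n (y n)| ^ 2 - |∑ n, ξ n (y n)| =
        (2 * σ)⁻¹ * (|∑ n, ξ n (y n)| - σ) ^ 2 := by
      field_simp
      ring
    rw [this]
    positivity
  rw [prodMean_add, prodMean_const H.law, prodMean_mul_left, H.mean_sq, hv] at h
  have : σ / 2 + (2 * σ)⁻¹ * σ ^ 2 = σ := by field_simp; ring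
  linarith

/-- Anticoncentration from a monotone test function. -/
lemma CentredSum.anticoncentration (H : CentredSum w ξ δ) {σ : ℝ} (hσ : 0 < σ)
    (hv : sumVar w ξ = σ ^ 2) {f h : ℝ → ℝ} {B : ℝ} (hB : ∀ x, |f x| ≤ B)
    (hfh : ∀ x s t, |s| ≤ δ → |t| ≤ δ → s ^ 2 * h (x + t) ≤ s * (f (x + s) - f x)) :
    σ * prodMean w (fun y => h (∑ n, ξ n (y n))) ≤ B := by
  have hB0 : 0 ≤ B := (abs_nonneg _).trans (hB 0)
  have h1 : prodMean w (fun y => (∑ n, ξ n (y n)) * f (∑ n, ξ n (y n))) ≤ B * σ := by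
    calc _ ≤ prodMean w (fun y => B * |∑ n, ξ n (y n)|) := by
          refine prodMean_mono H.law fun y => ?_
          refine (le_abs_self _).trans ?_
          rw [abs_mul, mul_comm]
          exact mul_le_mul_of_nonneg_right (hB _) (abs_nonneg _)
      _ ≤ B * σ := by
          rw [prodMean_mul_left]
          exact mul_le_mul_of_nonneg_left (H.mean_abs_le hσ hv) hB0
  have h2 : σ ^ 2 * prodMean w (fun y => h (∑ n, ξ n (y n))) ≤
      prodMean w (fun y => (∑ n, ξ n (y n)) * f (∑ n, ξ n (y n))) := by
    rw [H.mean_mul_eq, ← hv, sumVar, Finset.sum_mul]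
    refine Finset.sum_le_sum fun i _ => ?_
    rw [← prodMean_mul_left]
    refine prodMean_mono H.law fun y => ?_
    rw [Finset.sum_mul]
    refine Finset.sum_le_sum fun b _ => ?_
    rw [mul_assoc]
    refine mul_le_mul_of_nonneg_left ?_ ((H.law i).1 b)
    simpa using hfh (∑ n, ξ n (y n) - ξ i (y i)) (ξ i b) (ξ i (y i)) (H.bound _ _) (H.bound _ _)
  have h3 : σ * (σ * prodMean w (fun y => h (∑ n, ξ n (y n)))) ≤ σ * B := by linarith
  exact le_of_mul_le_mul_left h3 hσ

/-- A bounded sum with variance `σ²` lies in an interval of length `b - a` with probability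
of order `(b - a + δ) / σ`. -/
lemma CentredSum.mean_Icc_le (H : CentredSum w ξ δ) {σ : ℝ} (hσ : 0 < σ)
    (hv : sumVar w ξ = σ ^ 2) {a b : ℝ} (hδ : 0 ≤ δ) (hab : a ≤ b) :
    σ * prodMean w (fun y => (Set.Icc a b).indicator 1 (∑ n, ξ n (y n))) ≤
      (b - a) / 2 + 2 * δ := by
  set c := (b - a) / 2 + 2 * δ with hc
  have hc0 : 0 ≤ c := by have := sub_nonneg.2 hab; positivity
  refine H.anticoncentration hσ hv (f := fun x => max (-c) (min c (x - (a + b) / 2)))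
    (h := (Set.Icc a b).indicator 1) (fun x => abs_le.2 ⟨le_max_left _ _, max_le (by linarith)
      (min_le_left _ _)⟩) fun x s t hs ht => ?_
  rw [abs_le] at hs ht
  by_cases hx : x + t ∈ Set.Icc a b
  · rw [Set.indicator_of_mem hx, Pi.one_apply]
    obtain ⟨hx1, hx2⟩ := hx
    rw [min_eq_right (by linarith), max_eq_right (by linarith), min_eq_right (by linarith),
      max_eq_right (by linarith)]
    exact le_of_eq (by ring)
  · rw [Set.indicator_of_notMem hx, mul_zero]
    rcases le_total 0 s with h | h
    · refine mul_nonneg h (sub_nonneg.2 ?_)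
      gcongr
      linarith
    · refine mul_nonneg_of_nonpos_of_nonpos h (sub_nonpos.2 ?_)
      gcongr
      linarith

/-- Truncated exponential moments of a bounded sum with variance `σ²` gain a factor `1 / σ`. -/
lemma CentredSum.mean_exp_le (H : CentredSum w ξ δ) {σ : ℝ} (hσ : 0 < σ)
    (hv : sumVar w ξ = σ ^ 2) (T : ℝ) :
    σ * prodMean w (fun y => (Set.Iic T).indicator Real.exp (∑ n, ξ n (y n))) ≤
      Real.exp (T + 4 * δ) := by
  have hcancel : Real.exp (2 * δ) * Real.exp (-(2 * δ)) = 1 := by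
    rw [← Real.exp_add, add_neg_cancel, Real.exp_zero]
  have h := H.anticoncentration hσ hv (f := fun x => Real.exp (min x (T + 2 * δ)))
    (h := fun x => Real.exp (-(2 * δ)) * (Set.Iic T).indicator Real.exp x)
    (B := Real.exp (T + 2 * δ))
    (fun x => by
      rw [abs_of_pos (Real.exp_pos _)]
      exact Real.exp_le_exp.2 (min_le_right _ _)) fun x s t hs ht => ?_
  · rw [prodMean_mul_left] at h
    calc _ = Real.exp (2 * δ) * (σ * (Real.exp (-(2 * δ)) *
          prodMean w (fun y => (Set.Iic T).indicator Real.exp (∑ n, ξ n (y n))))) := by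
          linear_combination (-(σ *
            prodMean w (fun y => (Set.Iic T).indicator Real.exp (∑ n, ξ n (y n))))) * hcancel
      _ ≤ Real.exp (2 * δ) * Real.exp (T + 2 * δ) := by gcongr
      _ = Real.exp (T + 4 * δ) := by rw [← Real.exp_add]; ring_nf
  · rw [abs_le] at hs ht
    by_cases hx : x + t ∈ Set.Iic T
    · rw [Set.indicator_of_mem hx]
      have hx' : x + t ≤ T := hx
      rw [min_eq_left (by linarith), min_eq_left (by linarith), Real.exp_add x s]
      have h1 : Real.exp (-(2 * δ)) * Real.exp (x + t) ≤ Real.exp x * Real.exp (-δ) := by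
        rw [← Real.exp_add, ← Real.exp_add]
        apply Real.exp_le_exp.2
        linarith
      have h2 : s ^ 2 * Real.exp (-δ) ≤ s * (Real.exp s - 1) := by
        rcases le_total 0 s with h | h
        · have e1 : Real.exp (-δ) ≤ 1 := Real.exp_le_one_iff.2 (by linarith)
          have e2 := Real.add_one_le_exp s
          calc s ^ 2 * Real.exp (-δ) ≤ s ^ 2 * 1 := by gcongr
            _ = s * s := by ring
            _ ≤ _ := by gcongr; linarith
        · have e1 : Real.exp (-δ) ≤ Real.exp s := Real.exp_le_exp.2 (by linarith)
          have e2 := Real.add_one_le_exp (-s)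
          have e3 : Real.exp s * Real.exp (-s) = 1 := by
            rw [← Real.exp_add, add_neg_cancel, Real.exp_zero]
          have e4 : Real.exp s * (-s + 1) ≤ 1 := by
            exact (mul_le_mul_of_nonneg_left e2 (Real.exp_pos s).le).trans e3.le
          have e5 : s ^ 2 * Real.exp (-δ) ≤ s ^ 2 * Real.exp s := by gcongr
          nlinarith
      calc s ^ 2 * (Real.exp (-(2 * δ)) * Real.exp (x + t))
          ≤ s ^ 2 * (Real.exp x * Real.exp (-δ)) := by gcongr
        _ = Real.exp x * (s ^ 2 * Real.exp (-δ)) := by ring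
        _ ≤ Real.exp x * (s * (Real.exp s - 1)) := by gcongr
        _ = _ := by ring
    · rw [Set.indicator_of_notMem hx, mul_zero, mul_zero]
      rcases le_total 0 s with h | h
      · refine mul_nonneg h (sub_nonneg.2 ?_)
        gcongr
        linarith
      · refine mul_nonneg_of_nonpos_of_nonpos h (sub_nonpos.2 ?_)
        gcongr
        linarith

/-- A Berry-Esseen bound for the upper tail of a normalized bounded sum. -/
lemma CentredSum.berry_esseen (H : CentredSum w ξ δ) (hδ : 0 < δ) (hv : sumVar w ξ = 1) (z : ℝ) :
    prodMean w (fun y => (Set.Ioi (z + δ)).indicator 1 (∑ n, ξ n (y n))) ≤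
      1 - stdGaussCDF z + (2 * Real.sqrt (2 * Real.pi) + 9) * δ := by
  set Z := Real.sqrt (2 * Real.pi)
  obtain ⟨f, hf, hf1, hf2⟩ := exists_stein_solution (continuous_ramp z δ) (ramp_nonneg z δ)
    (ramp_le_one z δ)
  obtain ⟨hm0, hm1⟩ := gaussMean_mem_Icc (continuous_ramp z δ) (ramp_nonneg z δ)
    (ramp_le_one z δ)
  set m := gaussMean (ramp z δ) with hm
  have hlip : ∀ x t, |f (x + t) - f x| ≤ 2 * |t| := fun x t => by
    have := Convex.norm_image_sub_le_of_norm_hasDerivWithin_le (s := Set.univ) (C := 2)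
      (f := f) (x := x) (y := x + t) (fun u _ => (hf u).hasDerivWithinAt) (fun u _ => ?_)
      convex_univ trivial trivial
    · simpa using this
    · rw [Real.norm_eq_abs]
      have h3 : |ramp z δ u - m| ≤ 1 := by
        rw [abs_le]; constructor <;> linarith [ramp_nonneg z δ u, ramp_le_one z δ u]
      exact (abs_add_le _ _).trans (by linarith [hf2 u])
  set R : ℝ → ℝ := fun x => 2 * δ * Z + 4 * δ * |x| +
    (Set.Icc (z - 2 * δ) (z + 3 * δ)).indicator 1 x with hRdef
  have hR : ∀ x t, |t| ≤ 2 * δ → |((x + t) * f (x + t) + (ramp z δ (x + t) - m)) -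
      (x * f x + (ramp z δ x - m))| ≤ R x := fun x t ht => by
    have e1 : |t * f (x + t)| ≤ 2 * δ * Z := by
      rw [abs_mul]; exact mul_le_mul ht (hf1 _) (abs_nonneg _) (by linarith)
    have e2 : |x * (f (x + t) - f x)| ≤ 4 * δ * |x| := by
      rw [abs_mul]
      nlinarith [hlip x t, abs_nonneg x]
    have e3 : |ramp z δ (x + t) - ramp z δ x| ≤
        (Set.Icc (z - 2 * δ) (z + 3 * δ)).indicator 1 x := by
      have ht' := abs_le.1 ht
      by_cases hx : x ∈ Set.Icc (z - 2 * δ) (z + 3 * δ)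
      · rw [Set.indicator_of_mem hx, Pi.one_apply, abs_le]
        constructor <;>
          linarith [ramp_nonneg z δ x, ramp_le_one z δ x, ramp_nonneg z δ (x + t),
            ramp_le_one z δ (x + t)]
      · rw [Set.indicator_of_notMem hx]
        rw [Set.mem_Icc, not_and_or, not_le, not_le] at hx
        rcases hx with hx | hx
        · rw [ramp_eq_zero hδ (by linarith), ramp_eq_zero hδ (by linarith)]; simp
        · rw [ramp_eq_one hδ (by linarith), ramp_eq_one hδ (by linarith)]; simp
    calc _ = |t * f (x + t) + x * (f (x + t) - f x) + (ramp z δ (x + t) - ramp z δ x)| := by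
          ring_nf
      _ ≤ |t * f (x + t)| + |x * (f (x + t) - f x)| + |ramp z δ (x + t) - ramp z δ x| :=
          abs_add_three _ _ _
      _ ≤ R x := by simp only [hRdef]; linarith
  have hst := H.stein hf hR
  rw [hv, one_mul, one_mul, prodMean_add, prodMean_sub, prodMean_const H.law, abs_le] at hst
  have hRm : prodMean w (fun y => R (∑ n, ξ n (y n))) ≤
      2 * δ * Z + 4 * δ + (5 * δ / 2 + 2 * δ) := by
    simp only [hRdef]
    rw [prodMean_add, prodMean_add, prodMean_const H.law, prodMean_mul_left]
    have h1 := H.mean_abs_le one_pos (by rw [hv, one_pow])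
    have h2 := H.mean_Icc_le one_pos (by rw [hv, one_pow]) (a := z - 2 * δ) (b := z + 3 * δ)
      hδ.le (by linarith)
    nlinarith
  have hmono : prodMean w (fun y => (Set.Ioi (z + δ)).indicator 1 (∑ n, ξ n (y n))) ≤
      prodMean w (fun y => ramp z δ (∑ n, ξ n (y n))) := prodMean_mono H.law fun y => by
    by_cases hx : ∑ n, ξ n (y n) ∈ Set.Ioi (z + δ)
    · rw [Set.indicator_of_mem hx, ramp_eq_one hδ (le_of_lt hx), Pi.one_apply]
    · rw [Set.indicator_of_notMem hx]; exact ramp_nonneg _ _ _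
  have hgm := gaussMean_ramp_le (z := z) hδ
  linarith [hst.1]

end ProductLaw

/-! ### Capacity-achieving output laws of singular channels -/

/-- The output law induced by the input law `Q`. -/
noncomputable def outLaw (W : X → Y → ℝ) (Q : X → ℝ) (y : Y) : ℝ := ∑ z, Q z * W z y

lemma outLaw_nonneg {W : X → Y → ℝ} (hW : IsDMC W) {Q : X → ℝ} (hQ : IsProbDist Q) (y : Y) :
    0 ≤ outLaw W Q y :=
  Finset.sum_nonneg fun z _ => mul_nonneg (hQ.1 z) (hW.1 z y)

lemma sum_outLaw_mul (W : X → Y → ℝ) (Q : X → ℝ) (F : Y → ℝ) :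
    ∑ y, outLaw W Q y * F y = ∑ x, Q x * ∑ y, W x y * F y := by
  simp only [outLaw, Finset.sum_mul, Finset.mul_sum]
  rw [Finset.sum_comm]
  exact Finset.sum_congr rfl fun x _ => Finset.sum_congr rfl fun y _ => by ring

lemma sum_outLaw {W : X → Y → ℝ} (hW : IsDMC W) {Q : X → ℝ} (hQ : IsProbDist Q) :
    ∑ y, outLaw W Q y = 1 := by
  have h := sum_outLaw_mul W Q fun _ => 1
  simpa [hW.2, hQ.2] using h

lemma Singular.exists_gain {W : X → Y → ℝ} (hW : IsDMC W) (hsing : Singular W) :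
    ∃ a : Y → ℝ, (∀ y, 0 < a y) ∧ ∀ x y, W x y = 0 ∨ W x y = a y := by
  have h : ∀ y, ∃ c : ℝ, 0 < c ∧ ∀ x, W x y = 0 ∨ W x y = c := fun y => by
    by_cases hy : ∃ z, 0 < W z y
    · obtain ⟨z, hz⟩ := hy
      refine ⟨W z y, hz, fun x => ?_⟩
      rcases (hW.1 x y).eq_or_lt with h0 | h0
      · exact Or.inl h0.symm
      · exact Or.inr (hsing x z y (mul_pos h0 hz))
    · push Not at hy
      exact ⟨1, one_pos, fun x => Or.inl (le_antisymm (hy x) (hW.1 x y))⟩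
  choose a ha ha' using h
  exact ⟨a, ha, fun x y => ha' y x⟩

lemma mul_log_eq_of_gain {w a : ℝ} (h : w = 0 ∨ w = a) (c : ℝ) :
    w * Real.log (w / c) = w * Real.log (a / c) := by
  rcases h with h | h
  · simp [h]
  · rw [h]

lemma mutualInfo_eq_of_gain {W : X → Y → ℝ} {a : Y → ℝ} (ha : ∀ x y, W x y = 0 ∨ W x y = a y)
    (Q : X → ℝ) :
    mutualInfo W Q = ∑ y, outLaw W Q y * Real.log (a y / outLaw W Q y) := by
  rw [sum_outLaw_mul, mutualInfo]
  refine Finset.sum_congr rfl fun x _ => ?_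
  rw [Finset.mul_sum]
  refine Finset.sum_congr rfl fun y _ => ?_
  rw [mul_assoc, mul_log_eq_of_gain (ha x y)]
  rfl

lemma mutualInfo_le_capacity {W : X → Y → ℝ} (hW : IsDMC W) {a : Y → ℝ} (hpos : ∀ y, 0 < a y)
    (ha : ∀ x y, W x y = 0 ∨ W x y = a y) {Q : X → ℝ} (hQ : IsProbDist Q) :
    mutualInfo W Q ≤ capacity W := by
  refine le_csSup ⟨∑ y, a y, ?_⟩ ⟨Q, hQ, rfl⟩
  rintro r ⟨Q, hQ, rfl⟩
  rw [mutualInfo_eq_of_gain ha]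
  refine Finset.sum_le_sum fun y _ => ?_
  rcases (outLaw_nonneg hW hQ y).eq_or_lt with h | h
  · rw [← h, zero_mul]; exact (hpos y).le
  · calc outLaw W Q y * Real.log (a y / outLaw W Q y)
        ≤ outLaw W Q y * (a y / outLaw W Q y - 1) := by
          gcongr
          exact Real.log_le_sub_one_of_pos (div_pos (hpos y) h)
      _ = a y - outLaw W Q y := by field_simp
      _ ≤ a y := by linarith

/-- The optimality conditions for the output law `q` of a singular channel with gains `a`. -/
structure SingularOpt (W : X → Y → ℝ) (a q : Y → ℝ) (C : ℝ) : Prop where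
  dmc : IsDMC W
  gain_pos : ∀ y, 0 < a y
  gain : ∀ x y, W x y = 0 ∨ W x y = a y
  nonneg : ∀ y, 0 ≤ q y
  sum_eq : ∑ y, q y = 1
  pos : ∀ x y, 0 < W x y → 0 < q y
  kkt : ∀ x, ∑ y, W x y * Real.log (a y / q y) ≤ C
  val : ∑ y, q y * Real.log (a y / q y) = C

lemma mul_log_div_ge_of_pos {a q u : ℝ} (ha : 0 < a) (hq : 0 < q) (hu : 0 ≤ u) :
    u * Real.log (a / q) - (u - q) - (u - q) ^ 2 / q ≤ u * Real.log (a / u) := by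
  rcases hu.eq_or_lt with h | h
  · rw [← h]
    have : (0 - q) ^ 2 / q = q := by field_simp; ring
    rw [this]
    simp
  · have h1 : Real.log (a / q) - Real.log (a / u) = Real.log (u / q) := by
      rw [Real.log_div ha.ne' hq.ne', Real.log_div ha.ne' h.ne', Real.log_div h.ne' hq.ne']
      ring
    have h2 := mul_le_mul_of_nonneg_left (Real.log_le_sub_one_of_pos (div_pos h hq)) h.le
    have h3 : u * (u / q - 1) = (u - q) + (u - q) ^ 2 / q := by field_simp; ring
    rw [← h1] at h2
    linarith

omit [Fintype Y] in
lemma outLaw_mix (W : X → Y → ℝ) [DecidableEq X] (Q : X → ℝ) (x : X) (t : ℝ) (y : Y) :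
    outLaw W (fun z => (1 - t) * Q z + t * if z = x then 1 else 0) y =
      (1 - t) * outLaw W Q y + t * W x y := by
  simp only [outLaw, add_mul, Finset.sum_add_distrib, mul_assoc, ← Finset.mul_sum]
  simp

/-- The variational inequality at a capacity-achieving law. -/
lemma optimal_variation {W : X → Y → ℝ} [DecidableEq X] (hW : IsDMC W) {a : Y → ℝ}
    (hpos : ∀ y, 0 < a y) (ha : ∀ x y, W x y = 0 ∨ W x y = a y) {Q : X → ℝ} (hQ : IsProbDist Q)
    (hopt : mutualInfo W Q = capacity W) (x : X) {t : ℝ} (ht : 0 < t) (ht1 : t ≤ 1) :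
    (1 - Real.log t) * (∑ y, if outLaw W Q y = 0 then W x y else 0) +
      (∑ y, W x y * Real.log (a y / outLaw W Q y)) - capacity W ≤
      t * ∑ y, (W x y - outLaw W Q y) ^ 2 / outLaw W Q y := by
  set q := outLaw W Q with hq
  have hQt : IsProbDist (fun z => (1 - t) * Q z + t * if z = x then 1 else 0) := by
    refine ⟨fun z => ?_, ?_⟩
    · have := hQ.1 z
      have h1 : 0 ≤ 1 - t := by linarith
      dsimp only
      split_ifs <;> positivity
    · simp [Finset.sum_add_distrib, ← Finset.mul_sum, hQ.2]
  have h1 := mutualInfo_le_capacity hW hpos ha hQt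
  rw [mutualInfo_eq_of_gain ha] at h1
  simp only [outLaw_mix] at h1
  rw [← hq] at h1
  have hval := hopt
  rw [mutualInfo_eq_of_gain ha, ← hq] at hval
  have hpt : ∀ y, ((1 - t) * q y + t * W x y) * Real.log (a y / q y) - t * (W x y - q y) -
      t ^ 2 * ((W x y - q y) ^ 2 / q y) +
      (t - t * Real.log t) * (if q y = 0 then W x y else 0) ≤
      ((1 - t) * q y + t * W x y) * Real.log (a y / ((1 - t) * q y + t * W x y)) := fun y => by
    rcases (outLaw_nonneg hW hQ y).eq_or_lt with h | h
    · replace h : q y = 0 := h.symm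
      rw [if_pos h, h]
      rcases ha x y with h0 | h0
      · simp [h0]
      · have h2 : a y / ((1 - t) * 0 + t * a y) = t⁻¹ := by
          have := (hpos y).ne'
          field_simp
          ring
        rw [h0, h2, Real.log_inv, div_zero, div_zero, Real.log_zero]
        exact le_of_eq (by ring)
    · replace h : 0 < q y := h
      rw [if_neg h.ne']
      have h2 := mul_log_div_ge_of_pos (u := (1 - t) * q y + t * W x y) (hpos y) h
        (by have := hW.1 x y; have h1 : 0 ≤ 1 - t := by linarith
            positivity)
      refine le_trans (le_of_eq ?_) h2
      rw [show (1 - t) * q y + t * W x y - q y = t * (W x y - q y) by ring]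
      ring
  have h2 := (Finset.sum_le_sum fun y (_ : y ∈ univ) => hpt y).trans h1
  simp only [Finset.sum_add_distrib, Finset.sum_sub_distrib, ← Finset.mul_sum, add_mul, mul_assoc]
    at h2
  rw [hval, hW.2, sum_outLaw hW hQ] at h2
  have h3 : t * ((1 - Real.log t) * (∑ y, if q y = 0 then W x y else 0) +
      (∑ y, W x y * Real.log (a y / q y)) - capacity W) ≤
      t * (t * ∑ y, (W x y - q y) ^ 2 / q y) := by
    nlinarith
  exact le_of_mul_le_mul_left h3 ht

lemma singularOpt_of_optimal {W : X → Y → ℝ} (hW : IsDMC W) {a : Y → ℝ}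
    (hpos : ∀ y, 0 < a y) (ha : ∀ x y, W x y = 0 ∨ W x y = a y) {Q : X → ℝ} (hQ : IsProbDist Q)
    (hopt : mutualInfo W Q = capacity W) : SingularOpt W a (outLaw W Q) (capacity W) := by
  classical
  have hvar := fun x t => optimal_variation (t := t) hW hpos ha hQ hopt x
  have hval := hopt
  rw [mutualInfo_eq_of_gain ha] at hval
  have hnn : ∀ x y, 0 ≤ (if outLaw W Q y = 0 then W x y else 0) := fun x y => by
    split_ifs
    exacts [hW.1 x y, le_rfl]
  have hzero : ∀ x, (∑ y, if outLaw W Q y = 0 then W x y else 0) = 0 := fun x => by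
    refine le_antisymm ?_ (Finset.sum_nonneg fun y _ => hnn x y)
    by_contra! hc
    set s := ∑ y, if outLaw W Q y = 0 then W x y else 0
    set k := ∑ y, (W x y - outLaw W Q y) ^ 2 / outLaw W Q y
    have hk : 0 ≤ k := Finset.sum_nonneg fun y _ => div_nonneg (sq_nonneg _) (outLaw_nonneg hW hQ y)
    set D := ∑ y, W x y * Real.log (a y / outLaw W Q y)
    set n := |k + capacity W - D| / s with hn
    have hn0 : 0 ≤ n := by positivity
    have h := hvar x _ (Real.exp_pos (-n)) (Real.exp_le_one_iff.2 (by linarith))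
    rw [Real.log_exp] at h
    have h2 : Real.exp (-n) * k ≤ k :=
      mul_le_of_le_one_left hk (Real.exp_le_one_iff.2 (by linarith))
    have h3 : n * s = |k + capacity W - D| := by rw [hn]; field_simp
    have h4 := le_abs_self (k + capacity W - D)
    have h5 : (1 - -n) * s + D - capacity W ≤ k := h.trans h2
    nlinarith
  refine ⟨hW, hpos, ha, outLaw_nonneg hW hQ, sum_outLaw hW hQ, fun x y hxy => ?_, fun x => ?_, hval⟩
  · refine (outLaw_nonneg hW hQ y).lt_of_ne fun h => ?_
    have := (Finset.sum_eq_zero_iff_of_nonneg fun y _ => hnn x y).1 (hzero x) y (mem_univ y)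
    rw [if_pos h.symm] at this
    exact hxy.ne' this
  · set k := ∑ y, (W x y - outLaw W Q y) ^ 2 / outLaw W Q y with hk'
    have hk : 0 ≤ k := Finset.sum_nonneg fun y _ => div_nonneg (sq_nonneg _) (outLaw_nonneg hW hQ y)
    refine le_of_forall_pos_le_add fun e he => ?_
    have ht : 0 < min 1 (e / (k + 1)) := by positivity
    have h := hvar x _ ht (min_le_left _ _)
    rw [hzero, mul_zero, zero_add] at h
    have h2 : min 1 (e / (k + 1)) * k ≤ e / (k + 1) * (k + 1) :=
      mul_le_mul (min_le_right _ _) (by linarith) hk (by positivity)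
    rw [div_mul_cancel₀ _ (by positivity)] at h2
    linarith

/-- The dispersion at a capacity-achieving law depends on the output law only. -/
lemma Vdisp_eq_of_optimal {W : X → Y → ℝ} {a : Y → ℝ} {Q : X → ℝ} (hQ : IsProbDist Q) {C : ℝ}
    (H : SingularOpt W a (outLaw W Q) C) :
    Vdisp W Q = ∑ y, outLaw W Q y * (Real.log (a y / outLaw W Q y) - C) ^ 2 := by
  have hD : ∀ x, Q x = 0 ∨ ∑ y, W x y * Real.log (a y / outLaw W Q y) = C := fun x => by
    have h0 : ∑ x, Q x * (C - ∑ y, W x y * Real.log (a y / outLaw W Q y)) = 0 := by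
      simp only [mul_sub, Finset.sum_sub_distrib, ← Finset.sum_mul, hQ.2, ← sum_outLaw_mul, H.val]
      ring
    have := (Finset.sum_eq_zero_iff_of_nonneg fun x _ =>
      mul_nonneg (hQ.1 x) (sub_nonneg.2 (H.kkt x))).1 h0 x (mem_univ x)
    rcases mul_eq_zero.1 this with h | h
    · exact Or.inl h
    · exact Or.inr (by linarith)
  rw [sum_outLaw_mul, Vdisp]
  refine Finset.sum_congr rfl fun x _ => ?_
  rw [Finset.mul_sum]
  refine Finset.sum_congr rfl fun y _ => ?_
  have hsum : ∑ b, W x b * Real.log (W x b / ∑ z, Q z * W z b) =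
      ∑ b, W x b * Real.log (a b / outLaw W Q b) :=
    Finset.sum_congr rfl fun b _ => mul_log_eq_of_gain (H.gain x b) _
  rw [hsum, mul_assoc]
  rcases hD x with h | h
  · rw [h, zero_mul, zero_mul]
  · rw [h]
    rcases H.gain x y with h0 | h0
    · rw [h0, zero_mul, zero_mul]
    · rw [h0]
      rfl

lemma exists_singularOpt {W : X → Y → ℝ} (hW : IsDMC W) (hsing : Singular W) {ε : ℝ}
    (hε : 1 / 2 < ε) (hV : 0 < Veps W ε) :
    ∃ a q : Y → ℝ, SingularOpt W a q (capacity W) ∧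
      0 < ∑ y, q y * (Real.log (a y / q y) - capacity W) ^ 2 ∧
      ∑ y, q y * (Real.log (a y / q y) - capacity W) ^ 2 ≤ Veps W ε := by
  obtain ⟨a, hpos, ha⟩ := hsing.exists_gain hW
  rw [Veps, if_neg (by linarith)] at hV ⊢
  set S := {v | ∃ Q, IsProbDist Q ∧ mutualInfo W Q = capacity W ∧ v = Vdisp W Q}
  have hbdd : BddAbove S := by
    by_contra h
    rw [Real.sSup_of_not_bddAbove h] at hV
    exact lt_irrefl _ hV
  have hne : S.Nonempty := by
    by_contra h
    rw [Set.not_nonempty_iff_eq_empty.1 h, Real.sSup_empty] at hV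
    exact lt_irrefl _ hV
  obtain ⟨v, ⟨Q, hQ, hopt, rfl⟩, hv⟩ := exists_lt_of_lt_csSup hne hV
  have H := singularOpt_of_optimal hW hpos ha hQ hopt
  refine ⟨a, outLaw W Q, H, ?_⟩
  rw [← Vdisp_eq_of_optimal hQ H]
  exact ⟨hv, le_csSup hbdd ⟨Q, hQ, hopt, rfl⟩⟩

/-! ### Perturbation of the output law around the optimal one -/

/-- The conditional mean of `γ` given the input `x`. -/
noncomputable def condMean (W : X → Y → ℝ) (γ : Y → ℝ) (x : X) : ℝ := ∑ y, W x y * γ y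

/-- The conditional variance of `γ` given the input, averaged over the input law `P`. -/
noncomputable def condVar (W : X → Y → ℝ) (P : X → ℝ) (γ : Y → ℝ) : ℝ :=
  ∑ x, P x * ∑ y, W x y * (γ y - condMean W γ x) ^ 2

omit [Fintype X] in
lemma sum_mul_sub_condMean_sq {W : X → Y → ℝ} (hW : IsDMC W) (γ : Y → ℝ) (x : X) (c : ℝ) :
    ∑ y, W x y * (γ y - c) ^ 2 =
      ∑ y, W x y * (γ y - condMean W γ x) ^ 2 + (condMean W γ x - c) ^ 2 := by
  have h : ∀ t, ∑ y, W x y * (γ y - t) ^ 2 =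
      ∑ y, W x y * γ y ^ 2 - 2 * t * condMean W γ x + t ^ 2 := fun t => by
    have : ∀ y, W x y * (γ y - t) ^ 2 = W x y * γ y ^ 2 - 2 * t * (W x y * γ y) + W x y * t ^ 2 :=
      fun y => by ring
    simp only [this, Finset.sum_add_distrib, Finset.sum_sub_distrib, ← Finset.mul_sum,
      ← Finset.sum_mul, hW.2, condMean, one_mul]
  rw [h, h]
  ring

omit [Fintype X] in
lemma abs_condMean_sub_le {W : X → Y → ℝ} (hW : IsDMC W) {γ g : Y → ℝ} {c : ℝ}
    (h : ∀ y, |γ y - g y| ≤ c) (x : X) : |condMean W γ x - condMean W g x| ≤ c := by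
  rw [condMean, condMean, ← Finset.sum_sub_distrib]
  calc |∑ y, (W x y * γ y - W x y * g y)| ≤ ∑ y, W x y * c := by
        refine (Finset.abs_sum_le_sum_abs _ _).trans (Finset.sum_le_sum fun y _ => ?_)
        rw [← mul_sub, abs_mul, abs_of_nonneg (hW.1 x y)]
        exact mul_le_mul_of_nonneg_left (h y) (hW.1 x y)
    _ = c := by rw [← Finset.sum_mul, hW.2, one_mul]

omit [Fintype X] in
lemma abs_condMean_le {W : X → Y → ℝ} (hW : IsDMC W) {γ : Y → ℝ} {c : ℝ}
    (h : ∀ y, |γ y| ≤ c) (x : X) : |condMean W γ x| ≤ c := by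
  have := abs_condMean_sub_le hW (γ := γ) (g := 0) (c := c) (by simpa using h) x
  simpa [condMean] using this

lemma condVar_le {W : X → Y → ℝ} (hW : IsDMC W) {P : X → ℝ} (hP : IsProbDist P) (γ : Y → ℝ)
    (c : ℝ) : condVar W P γ ≤ ∑ y, outLaw W P y * (γ y - c) ^ 2 := by
  rw [sum_outLaw_mul, condVar]
  refine Finset.sum_le_sum fun x _ => mul_le_mul_of_nonneg_left ?_ (hP.1 x)
  rw [sum_mul_sub_condMean_sq hW γ x c]
  linarith [sq_nonneg (condMean W γ x - c)]

lemma condVar_eq {W : X → Y → ℝ} (hW : IsDMC W) (P : X → ℝ) (γ : Y → ℝ) :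
    condVar W P γ = ∑ y, outLaw W P y * γ y ^ 2 - ∑ x, P x * condMean W γ x ^ 2 := by
  rw [sum_outLaw_mul, condVar, ← Finset.sum_sub_distrib]
  refine Finset.sum_congr rfl fun x _ => ?_
  have := sum_mul_sub_condMean_sq hW γ x 0
  simp only [sub_zero] at this
  rw [this]
  ring

lemma abs_log_div_sub_le {a q r η : ℝ} (ha : 0 < a) (hη : 0 < η) (hq : η ≤ q) (hr : 0 ≤ r) :
    |Real.log (a / ((q + r) / 2)) - Real.log (a / q)| ≤ |r - q| / η := by
  have hq0 : 0 < q := hη.trans_le hq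
  have hp : 0 < (q + r) / 2 := by linarith
  have h1 := Real.log_le_sub_one_of_pos (div_pos hq0 hp)
  have h2 := Real.log_le_sub_one_of_pos (div_pos hp hq0)
  rw [Real.log_div hq0.ne' hp.ne'] at h1
  rw [Real.log_div hp.ne' hq0.ne'] at h2
  rw [Real.log_div ha.ne' hq0.ne', Real.log_div ha.ne' hp.ne', abs_le]
  have h3 : q / ((q + r) / 2) - 1 = (q - r) / (q + r) := by
    have : q + r ≠ 0 := by linarith
    field_simp
    ring
  have h4 : (q + r) / 2 / q - 1 = (r - q) / (2 * q) := by field_simp; ring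
  have h5 : (q - r) / (q + r) ≤ |r - q| / η := by
    rw [abs_sub_comm]
    exact div_le_div₀ (abs_nonneg _) (le_abs_self _) hη (by linarith)
  have h6 : (r - q) / (2 * q) ≤ |r - q| / η :=
    div_le_div₀ (abs_nonneg _) (le_abs_self _) hη (by linarith)
  constructor <;> linarith

lemma mul_log_div_midpoint_le {a q r : ℝ} (ha : 0 < a) (hq : 0 < q) (hr : 0 ≤ r) (hq1 : q ≤ 1)
    (hr1 : r ≤ 1) : r * Real.log (a / ((q + r) / 2)) ≤
      r * Real.log (a / q) - (r - q) / 2 - (r - q) ^ 2 / 4 := by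
  have hp : 0 < (q + r) / 2 := by linarith
  have h1 := mul_le_mul_of_nonneg_left (Real.log_le_sub_one_of_pos (div_pos hq hp)) hr
  rw [Real.log_div hq.ne' hp.ne'] at h1
  rw [Real.log_div ha.ne' hq.ne', Real.log_div ha.ne' hp.ne']
  have h3 : r * (q / ((q + r) / 2) - 1) = -((r - q) / 2) - (r - q) ^ 2 / (2 * (q + r)) := by
    have : q + r ≠ 0 := by linarith
    field_simp
    ring
  have h4 : (r - q) ^ 2 / 4 ≤ (r - q) ^ 2 / (2 * (q + r)) :=
    div_le_div_of_nonneg_left (sq_nonneg _) (by linarith) (by linarith)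
  linarith

lemma abs_sq_sub_sq_le {u v b c : ℝ} (hu : |u| ≤ b) (hv : |v| ≤ b) (h : |u - v| ≤ c) :
    |u ^ 2 - v ^ 2| ≤ 2 * b * c := by
  rw [sq_sub_sq, abs_mul]
  exact mul_le_mul ((abs_add_le u v).trans (by linarith)) h (abs_nonneg _)
    (by linarith [abs_nonneg u])

/-- An auxiliary output law `p` and log-likelihood `γ` adapted to the input law `P`, at distance
`s` from the optimal output law and with optimality gap `D`. -/
structure Tilting (W : X → Y → ℝ) (C V B L : ℝ) (P : X → ℝ) (p γ : Y → ℝ) (s D : ℝ) : Prop where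
  dist_nonneg : 0 ≤ s
  gap_nonneg : 0 ≤ D
  nonneg : ∀ y, 0 ≤ p y
  sum_eq : ∑ y, p y = 1
  bound : ∀ y, |γ y| ≤ B
  dom : ∀ x y, W x y ≤ p y * Real.exp (γ y)
  mean_le : ∑ x, P x * condMean W γ x ≤ C - D - s ^ 2 / 4
  var_near : |condVar W P γ - V| ≤ L * (s + D)
  var_le : ∀ c, condVar W P γ ≤ 2 * ∑ y, p y * (γ y - c) ^ 2

lemma SingularOpt.exists_tilting {W : X → Y → ℝ} {a q : Y → ℝ} {C : ℝ}
    (H : SingularOpt W a q C) :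
    ∃ B L : ℝ, 0 < B ∧ 0 < L ∧ |C| ≤ B ∧ ∀ P : X → ℝ, IsProbDist P → ∃ p γ s D,
      Tilting W C (∑ y, q y * (Real.log (a y / q y) - C) ^ 2) B L P p γ s D := by
  set g : Y → ℝ := fun y => Real.log (a y / q y) with hg
  obtain ⟨η, hη, hηq⟩ : ∃ η : ℝ, 0 < η ∧ ∀ y, q y = 0 ∨ η ≤ q y := by
    have hne : (insert 1 ((univ.filter fun y => q y ≠ 0).image q)).Nonempty :=
      Finset.insert_nonempty _ _
    refine ⟨(insert 1 ((univ.filter fun y => q y ≠ 0).image q)).min' hne, ?_, fun y => ?_⟩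
    · rw [Finset.lt_min'_iff]
      intro t ht
      rcases Finset.mem_insert.1 ht with rfl | ht
      · exact one_pos
      · obtain ⟨y, hy, rfl⟩ := Finset.mem_image.1 ht
        exact (H.nonneg y).lt_of_ne' (Finset.mem_filter.1 hy).2
    · by_cases hy : q y = 0
      · exact Or.inl hy
      · exact Or.inr (Finset.min'_le _ _ (Finset.mem_insert_of_mem
          (Finset.mem_image_of_mem q (Finset.mem_filter.2 ⟨mem_univ y, hy⟩))))
  set B := ∑ y, |g y| + 1 / η + |C| with hB
  have hgB : ∀ y, |g y| + 1 / η ≤ B := fun y => by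
    have := Finset.single_le_sum (f := fun y => |g y|) (fun y _ => abs_nonneg _) (mem_univ y)
    have := abs_nonneg C
    linarith
  have hS0 : 0 ≤ ∑ y, |g y| := Finset.sum_nonneg fun y _ => abs_nonneg _
  have hη' : 0 < 1 / η := by positivity
  have hB0 : 0 < B := by positivity
  have hCB : |C| ≤ B := by linarith
  have hgB' : ∀ y, |g y| ≤ B := fun y => by linarith [hgB y]
  have hq1 : ∀ y, q y ≤ 1 := fun y =>
    (Finset.single_le_sum (fun y _ => H.nonneg y) (mem_univ y)).trans_eq H.sum_eq
  set L := 4 * B / η + Fintype.card Y * B ^ 2 + 2 * B with hL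
  refine ⟨B, L, hB0, by positivity, hCB, fun P hP => ?_⟩
  set r := outLaw W P with hr
  have hr0 : ∀ y, 0 ≤ r y := outLaw_nonneg H.dmc hP
  have hrsum : ∑ y, r y = 1 := sum_outLaw H.dmc hP
  have hr1 : ∀ y, r y ≤ 1 := fun y =>
    (Finset.single_le_sum (fun y _ => hr0 y) (mem_univ y)).trans_eq hrsum
  have hWq : ∀ x y, q y = 0 → W x y = 0 := fun x y h => by
    by_contra hne
    exact (H.pos x y ((H.dmc.1 x y).lt_of_ne' hne)).ne' h
  have hrq : ∀ y, q y = 0 → r y = 0 := fun y h =>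
    Finset.sum_eq_zero fun x _ => by rw [hWq x y h, mul_zero]
  set p : Y → ℝ := fun y => (q y + r y) / 2 with hp
  set γ : Y → ℝ := fun y => Real.log (a y / p y) with hγ
  set s := √(∑ y, (r y - q y) ^ 2) with hs
  have hs2 : s ^ 2 = ∑ y, (r y - q y) ^ 2 :=
    Real.sq_sqrt (Finset.sum_nonneg fun y _ => sq_nonneg _)
  have hrs : ∀ y, |r y - q y| ≤ s := fun y =>
    Real.abs_le_sqrt (Finset.single_le_sum (f := fun y => (r y - q y) ^ 2)
      (fun y _ => sq_nonneg _) (mem_univ y))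
  set D := ∑ x, P x * (C - condMean W g x) with hD
  have hgap : ∀ x, 0 ≤ C - condMean W g x := fun x => sub_nonneg.2 (H.kkt x)
  have hD0 : 0 ≤ D := Finset.sum_nonneg fun x _ => mul_nonneg (hP.1 x) (hgap x)
  have hDeq : ∑ y, r y * g y = C - D := by
    rw [sum_outLaw_mul, hD]
    simp only [mul_sub, Finset.sum_sub_distrib, ← Finset.sum_mul, hP.2]
    simp only [condMean]
    ring
  have hγg : ∀ y, |γ y - g y| ≤ |r y - q y| / η := fun y => by
    rcases hηq y with h | h
    · have : γ y = g y := by simp [hγ, hg, hp, h, hrq y h]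
      rw [this, sub_self, abs_zero]
      positivity
    · exact abs_log_div_sub_le (H.gain_pos y) hη h (hr0 y)
  have hγs : ∀ y, |γ y - g y| ≤ s / η := fun y =>
    (hγg y).trans (div_le_div_of_nonneg_right (hrs y) hη.le)
  have hγB : ∀ y, |γ y| ≤ B := fun y => by
    have h1 : |r y - q y| / η ≤ 1 / η := by
      refine div_le_div_of_nonneg_right ?_ hη.le
      rw [abs_le]
      constructor <;> linarith [hr0 y, hr1 y, H.nonneg y, hq1 y]
    have h2 := abs_add_le (γ y - g y) (g y)
    rw [sub_add_cancel] at h2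
    linarith [hγg y, hgB y]
  have hmean : ∑ y, r y * γ y ≤ C - D - s ^ 2 / 4 := by
    have hpt : ∀ y, r y * γ y ≤ r y * g y - (r y - q y) / 2 - (r y - q y) ^ 2 / 4 := fun y => by
      rcases hηq y with h | h
      · simp [h, hrq y h]
      · exact mul_log_div_midpoint_le (H.gain_pos y) (hη.trans_le h) (hr0 y) (hq1 y) (hr1 y)
    refine (Finset.sum_le_sum fun y _ => hpt y).trans_eq ?_
    rw [Finset.sum_sub_distrib, Finset.sum_sub_distrib, hDeq, ← Finset.sum_div, ← Finset.sum_div,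
      ← hs2, Finset.sum_sub_distrib, hrsum, H.sum_eq]
    ring
  have hV : ∑ y, q y * (g y - C) ^ 2 = ∑ y, q y * g y ^ 2 - C ^ 2 := by
    have : ∀ y, q y * (g y - C) ^ 2 = q y * g y ^ 2 - 2 * C * (q y * g y) + q y * C ^ 2 :=
      fun y => by ring
    simp only [this, Finset.sum_add_distrib, Finset.sum_sub_distrib, ← Finset.mul_sum,
      ← Finset.sum_mul, H.sum_eq]
    rw [H.val]
    ring
  have hsecond : |∑ y, r y * γ y ^ 2 - ∑ y, q y * g y ^ 2| ≤
      Fintype.card Y * (s * B ^ 2) + 2 * B * (s / η) := by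
    have hpt : ∀ y, |r y * γ y ^ 2 - q y * g y ^ 2| ≤ s * B ^ 2 + q y * (2 * B * (s / η)) :=
      fun y => by
        rw [show r y * γ y ^ 2 - q y * g y ^ 2 =
          (r y - q y) * γ y ^ 2 + q y * (γ y ^ 2 - g y ^ 2) by ring]
        refine (abs_add_le _ _).trans (add_le_add ?_ ?_)
        · rw [abs_mul, abs_of_nonneg (sq_nonneg (γ y)), ← sq_abs (γ y)]
          exact mul_le_mul (hrs y) (pow_le_pow_left₀ (abs_nonneg _) (hγB y) 2) (by positivity)
            (Real.sqrt_nonneg _)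
        · rw [abs_mul, abs_of_nonneg (H.nonneg y)]
          exact mul_le_mul_of_nonneg_left (abs_sq_sub_sq_le (hγB y) (hgB' y) (hγs y)) (H.nonneg y)
    rw [← Finset.sum_sub_distrib]
    refine (Finset.abs_sum_le_sum_abs _ _).trans
      ((Finset.sum_le_sum fun y _ => hpt y).trans_eq ?_)
    rw [Finset.sum_add_distrib, ← Finset.sum_mul univ q, H.sum_eq, one_mul]
    simp
  have hfirst : |∑ x, P x * condMean W γ x ^ 2 - C ^ 2| ≤ 2 * B * (s / η + D) := by
    have hpt : ∀ x, |P x * (condMean W γ x ^ 2 - C ^ 2)| ≤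
        2 * B * (P x * (s / η) + P x * (C - condMean W g x)) := fun x => by
      rw [abs_mul, abs_of_nonneg (hP.1 x), ← mul_add, mul_left_comm]
      refine mul_le_mul_of_nonneg_left ?_ (hP.1 x)
      refine abs_sq_sub_sq_le (abs_condMean_le H.dmc hγB x) hCB ?_
      have h1 := abs_condMean_sub_le H.dmc hγs x
      have h2 := abs_sub_le (condMean W γ x) (condMean W g x) C
      have h3 : |condMean W g x - C| = C - condMean W g x := by
        rw [abs_sub_comm, abs_of_nonneg (hgap x)]
      linarith
    have h1 : ∑ x, P x * condMean W γ x ^ 2 - C ^ 2 =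
        ∑ x, P x * (condMean W γ x ^ 2 - C ^ 2) := by
      simp only [mul_sub, Finset.sum_sub_distrib, ← Finset.sum_mul, hP.2, one_mul]
    rw [h1]
    refine (Finset.abs_sum_le_sum_abs _ _).trans
      ((Finset.sum_le_sum fun x _ => hpt x).trans_eq ?_)
    rw [← Finset.mul_sum, Finset.sum_add_distrib, ← Finset.sum_mul, hP.2, one_mul]
  refine ⟨p, γ, s, D, Real.sqrt_nonneg _, hD0, fun y => ?_, ?_, hγB, fun x y => ?_, ?_, ?_,
    fun c => ?_⟩
  · have := H.nonneg y
    have := hr0 y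
    simp only [hp]
    positivity
  · rw [← Finset.sum_div, Finset.sum_add_distrib, H.sum_eq, hrsum]
    norm_num
  · rcases hηq y with h | h
    · simp [hWq x y h, hp, h, hrq y h]
    · have hp0 : 0 < p y := by
        have := hr0 y
        simp only [hp]
        linarith
      have h1 : p y * Real.exp (γ y) = a y := by
        rw [hγ]
        dsimp only
        rw [Real.exp_log (div_pos (H.gain_pos y) hp0)]
        field_simp
      rw [h1]
      rcases H.gain x y with h0 | h0
      · rw [h0]
        exact (H.gain_pos y).le
      · exact h0.le
  · rw [sum_outLaw_mul] at hmean
    exact hmean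
  · rw [hV, condVar_eq H.dmc]
    rw [abs_le] at *
    have h1 : L * (s + D) = Fintype.card Y * (s * B ^ 2) + 2 * B * (s / η) + 2 * B * (s / η + D) +
        (2 * B * s + (4 * B / η + Fintype.card Y * B ^ 2) * D) := by
      rw [hL]
      field_simp
      ring
    have h2 : 0 ≤ 2 * B * s + (4 * B / η + Fintype.card Y * B ^ 2) * D := by
      have := Real.sqrt_nonneg (∑ y, (r y - q y) ^ 2)
      positivity
    constructor <;> linarith [hsecond.1, hsecond.2, hfirst.1, hfirst.2]
  · refine (condVar_le H.dmc hP γ c).trans ?_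
    rw [Finset.mul_sum]
    refine Finset.sum_le_sum fun y _ => ?_
    have h1 : outLaw W P y ≤ 2 * p y := by
      have := H.nonneg y
      simp only [hp, ← hr]
      linarith
    calc outLaw W P y * (γ y - c) ^ 2 ≤ 2 * p y * (γ y - c) ^ 2 :=
          mul_le_mul_of_nonneg_right h1 (sq_nonneg _)
      _ = 2 * (p y * (γ y - c) ^ 2) := by ring

/-! ### Converse bounds for constant composition codes -/

omit [Fintype X] in
/-- Changing the output measure to a product law below a likelihood threshold. -/
lemma converse_of_dominated {W : X → Y → ℝ} (hW : IsDMC W) {p γ : Y → ℝ}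
    (hdom : ∀ x y, W x y ≤ p y * Real.exp (γ y)) {N M : ℕ} (hM : 0 < M)
    {f : Fin M → Fin N → X} {φ : (Fin N → Y) → Fin M} {ε α β T : ℝ}
    (herr : avgErrorProb W f φ ≤ ε)
    (hα : ∀ m, prodMean (fun n => W (f m n))
      (fun y => (Set.Ioi T).indicator 1 (∑ n, γ (y n))) ≤ α)
    (hβ : prodMean (fun _ : Fin N => p)
      (fun y => (Set.Iic T).indicator Real.exp (∑ n, γ (y n))) ≤ β) :
    M * (1 - ε - α) ≤ β := by
  have hM' : (0 : ℝ) < M := Nat.cast_pos.2 hM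
  have hlaw : ∀ m, IsLaw fun n => W (f m n) := fun m n => ⟨hW.1 _, hW.2 _⟩
  have hcorrect : ∀ m, ∑ y, (if φ y = m then ∏ n, W (f m n) (y n) else 0) =
      1 - msgErrorProb W f φ m := fun m => by
    have h1 := prodMean_const (hlaw m) 1
    simp only [prodMean, mul_one] at h1
    rw [← h1, msgErrorProb, ← Finset.sum_filter,
      ← Finset.sum_filter_add_sum_filter_not univ (fun y => φ y = m), add_sub_cancel_right]
  have hpt : ∀ m y, (if φ y = m then ∏ n, W (f m n) (y n) else 0) ≤
      (∏ n, W (f m n) (y n)) * (Set.Ioi T).indicator 1 (∑ n, γ (y n)) +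
      if φ y = m then (∏ n, p (y n)) * (Set.Iic T).indicator Real.exp (∑ n, γ (y n)) else 0 :=
    fun m y => by
      have h0 : 0 ≤ ∏ n, W (f m n) (y n) := Finset.prod_nonneg fun n _ => hW.1 _ _
      rcases lt_or_ge T (∑ n, γ (y n)) with h | h
      · rw [Set.indicator_of_mem (Set.mem_Ioi.2 h), Set.indicator_of_notMem (by simpa using h)]
        split_ifs <;> simp [h0]
      · rw [Set.indicator_of_notMem (by simpa using h), Set.indicator_of_mem (Set.mem_Iic.2 h)]
        split_ifs
        · rw [mul_zero, zero_add, Real.exp_sum, ← Finset.prod_mul_distrib]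
          exact Finset.prod_le_prod (fun n _ => hW.1 _ _) fun n _ => hdom _ _
        · simp
  have h1 : ∑ m, (1 - msgErrorProb W f φ m) ≤ M * α + β := by
    simp only [← hcorrect]
    refine (Finset.sum_le_sum fun m _ => Finset.sum_le_sum fun y _ => hpt m y).trans ?_
    simp only [Finset.sum_add_distrib]
    refine add_le_add ?_ ?_
    · refine (Finset.sum_le_sum fun m _ => hα m).trans_eq ?_
      simp
    · rw [Finset.sum_comm]
      refine le_of_eq_of_le (Finset.sum_congr rfl fun y _ => ?_) hβ
      simp
  rw [Finset.sum_sub_distrib] at h1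
  simp only [Finset.sum_const, Finset.card_univ, Fintype.card_fin, nsmul_eq_mul, mul_one] at h1
  rw [avgErrorProb, inv_mul_le_iff₀ hM'] at herr
  linarith

lemma log_le_of_mul_le {M c t : ℝ} (hM : 0 < M) (hc : 0 < c) (h : M * c ≤ Real.exp t) :
    Real.log M ≤ t - Real.log c := by
  have := Real.log_le_log (mul_pos hM hc) h
  rw [Real.log_mul hM.ne' hc.ne', Real.log_exp] at this
  linarith

omit [Fintype Y] in
lemma sum_comp_eq_card [DecidableEq X] {N : ℕ} (c : Fin N → X) (F : X → ℝ) :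
    ∑ n, F (c n) = ∑ x, ((univ.filter fun n => c n = x).card : ℝ) * F x := by
  rw [← Finset.sum_fiberwise univ c]
  refine Finset.sum_congr rfl fun x _ => ?_
  rw [← nsmul_eq_mul, ← Finset.sum_const]
  exact Finset.sum_congr rfl fun n hn => by rw [(Finset.mem_filter.1 hn).2]

omit [Fintype Y] in
lemma ConstComp.exists_type [DecidableEq X] {N M : ℕ} (hN : 0 < N) (hM : 0 < M)
    {f : Fin M → Fin N → X} (hf : ConstComp f) :
    ∃ P : X → ℝ, IsProbDist P ∧ ∀ m (F : X → ℝ), ∑ n, F (f m n) = N * ∑ x, P x * F x := by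
  have hN' : (N : ℝ) ≠ 0 := Nat.cast_ne_zero.2 hN.ne'
  have key : ∀ m (F : X → ℝ), ∑ n, F (f m n) =
      N * ∑ x, ((univ.filter fun n => f ⟨0, hM⟩ n = x).card / N : ℝ) * F x := fun m F => by
    rw [sum_comp_eq_card, Finset.mul_sum]
    refine Finset.sum_congr rfl fun x _ => ?_
    rw [hf m ⟨0, hM⟩ x]
    field_simp
  refine ⟨_, ⟨fun x => by positivity, ?_⟩, key⟩
  have h := key ⟨0, hM⟩ fun _ => 1
  simp only [mul_one, Finset.sum_const, Finset.card_univ, Fintype.card_fin, nsmul_eq_mul] at h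
  exact mul_left_cancel₀ hN' (h.symm.trans (mul_one _).symm)

omit [Fintype X] in
lemma abs_sub_condMean_le {W : X → Y → ℝ} (hW : IsDMC W) {γ : Y → ℝ} {B : ℝ}
    (h : ∀ y, |γ y| ≤ B) (x : X) (y : Y) : |γ y - condMean W γ x| ≤ 2 * B := by
  have := abs_sub (γ y) (condMean W γ x)
  linarith [h y, abs_condMean_le hW h x]

lemma condVar_le_sq {W : X → Y → ℝ} (hW : IsDMC W) {P : X → ℝ} (hP : IsProbDist P) {γ : Y → ℝ}
    {B : ℝ} (h : ∀ y, |γ y| ≤ B) : condVar W P γ ≤ (2 * B) ^ 2 := by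
  calc condVar W P γ ≤ ∑ x, P x * ∑ y, W x y * (2 * B) ^ 2 := by
        refine Finset.sum_le_sum fun x _ => mul_le_mul_of_nonneg_left
          (Finset.sum_le_sum fun y _ => mul_le_mul_of_nonneg_left ?_ (hW.1 x y)) (hP.1 x)
        rw [← sq_abs]
        exact pow_le_pow_left₀ (abs_nonneg _) (abs_sub_condMean_le hW h x y) 2
    _ = (2 * B) ^ 2 := by simp only [← Finset.sum_mul, hW.2, hP.2, one_mul]

section Codeword

variable {W : X → Y → ℝ} {P : X → ℝ} {γ : Y → ℝ} {B : ℝ} {N : ℕ} {c : Fin N → X}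

omit [Fintype X] in
lemma centredSum_codeword (hW : IsDMC W) (hγ : ∀ y, |γ y| ≤ B) (c : Fin N → X) {k : ℝ}
    (hk : 0 ≤ k) : CentredSum (fun n => W (c n)) (fun n y => k * (γ y - condMean W γ (c n)))
      (k * (2 * B)) := by
  refine ⟨fun n => ⟨hW.1 _, hW.2 _⟩, fun n => ?_, fun n y => ?_⟩
  · simp only [mul_left_comm _ k, ← Finset.mul_sum, mul_sub, Finset.sum_sub_distrib,
      ← Finset.sum_mul, hW.2, one_mul]
    simp [condMean]
  · rw [abs_mul, abs_of_nonneg hk]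
    exact mul_le_mul_of_nonneg_left (abs_sub_condMean_le hW hγ _ _) hk

lemma sumVar_codeword (hc : ∀ F : X → ℝ, ∑ n, F (c n) = N * ∑ x, P x * F x) (k : ℝ) :
    sumVar (fun n => W (c n)) (fun n y => k * (γ y - condMean W γ (c n))) =
      k ^ 2 * (N * condVar W P γ) := by
  simp only [sumVar, mul_pow, mul_left_comm _ (k ^ 2), ← Finset.mul_sum]
  rw [hc fun x => ∑ y, W x y * (γ y - condMean W γ x) ^ 2]
  rfl

lemma sum_codeword (hc : ∀ F : X → ℝ, ∑ n, F (c n) = N * ∑ x, P x * F x) (k : ℝ)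
    (y : Fin N → Y) : ∑ n, k * (γ (y n) - condMean W γ (c n)) =
      k * (∑ n, γ (y n) - N * ∑ x, P x * condMean W γ x) := by
  rw [← Finset.mul_sum, Finset.sum_sub_distrib, hc]

/-- Chebyshev bound on the upper tail of the log-likelihood. -/
lemma chebyshev_codeword (hW : IsDMC W) (hP : IsProbDist P) (hγ : ∀ y, |γ y| ≤ B)
    (hc : ∀ F : X → ℝ, ∑ n, F (c n) = N * ∑ x, P x * F x) (hN : 0 < N) {κ : ℝ} (hκ : 0 < κ) :
    prodMean (fun n => W (c n)) (fun y =>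
      (Set.Ioi (N * ∑ x, P x * condMean W γ x + κ * √N)).indicator 1 (∑ n, γ (y n))) ≤ (2 * B) ^ 2 / κ ^ 2 := by
  have hN' : (0 : ℝ) < N := Nat.cast_pos.2 hN
  have hs : √(N : ℝ) ^ 2 = N := Real.sq_sqrt hN'.le
  have hs0 : 0 < √(N : ℝ) := Real.sqrt_pos.2 hN'
  have H := centredSum_codeword hW hγ c (zero_le_one (α := ℝ))
  have hsq := H.mean_sq
  rw [sumVar_codeword hc] at hsq
  simp only [sum_codeword hc] at hsq
  have hpt : ∀ y : Fin N → Y, (Set.Ioi (N * ∑ x, P x * condMean W γ x + κ * √N)).indicator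
      (1 : ℝ → ℝ) (∑ n, γ (y n)) ≤ (κ ^ 2 * N)⁻¹ *
      (1 * (∑ n, γ (y n) - N * ∑ x, P x * condMean W γ x)) ^ 2 := fun y => by
    by_cases h : N * ∑ x, P x * condMean W γ x + κ * √N < ∑ n, γ (y n)
    · rw [Set.indicator_of_mem (Set.mem_Ioi.2 h), Pi.one_apply, inv_mul_eq_div,
        one_le_div (by positivity), one_mul]
      calc κ ^ 2 * N = (κ * √N) ^ 2 := by rw [mul_pow, hs]
        _ ≤ _ := pow_le_pow_left₀ (by positivity) (by linarith) 2
    · rw [Set.indicator_of_notMem (by simpa using h)]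
      positivity
  refine (prodMean_mono H.law hpt).trans ?_
  rw [prodMean_mul_left, hsq]
  have h1 := condVar_le_sq hW hP hγ
  calc (κ ^ 2 * N)⁻¹ * (1 ^ 2 * (N * condVar W P γ)) = condVar W P γ / κ ^ 2 := by field_simp
    _ ≤ _ := by gcongr

/-- Normal approximation bound on the upper tail of the log-likelihood. -/
lemma berry_esseen_codeword (hW : IsDMC W) (hγ : ∀ y, |γ y| ≤ B) (hB : 0 < B)
    (hc : ∀ F : X → ℝ, ∑ n, F (c n) = N * ∑ x, P x * F x) (hN : 0 < N)
    (hv : 0 < condVar W P γ) (z : ℝ) :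
    prodMean (fun n => W (c n)) (fun y => (Set.Ioi (N * ∑ x, P x * condMean W γ x +
      (√(N * condVar W P γ) * z + 2 * B))).indicator 1 (∑ n, γ (y n))) ≤
      1 - stdGaussCDF z + (2 * √(2 * π) + 9) * (2 * B / √(N * condVar W P γ)) := by
  have hN' : (0 : ℝ) < N := Nat.cast_pos.2 hN
  set σ := √(N * condVar W P γ) with hσ
  have hσ0 : 0 < σ := Real.sqrt_pos.2 (by positivity)
  have hσ2 : σ ^ 2 = N * condVar W P γ := Real.sq_sqrt (by positivity)
  have H := centredSum_codeword hW hγ c (inv_nonneg.2 hσ0.le)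
  have hvar := sumVar_codeword (W := W) (γ := γ) hc σ⁻¹
  rw [← hσ2, inv_pow, inv_mul_cancel₀ (by positivity)] at hvar
  have h := H.berry_esseen (by positivity) hvar z
  simp only [sum_codeword hc] at h
  rw [inv_mul_eq_div] at h
  refine le_of_eq_of_le ?_ h
  congr 1
  ext y
  have : ∑ n, γ (y n) ∈ Set.Ioi (N * ∑ x, P x * condMean W γ x + (σ * z + 2 * B)) ↔
      σ⁻¹ * (∑ n, γ (y n) - N * ∑ x, P x * condMean W γ x) ∈ Set.Ioi (z + 2 * B / σ) := by
    rw [Set.mem_Ioi, Set.mem_Ioi, inv_mul_eq_div, lt_div_iff₀ hσ0, add_mul,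
      div_mul_cancel₀ _ hσ0.ne']
    constructor <;> intro h <;> linarith
  simp only [Set.indicator, this]
  rfl

end Codeword

section OutputLaw

variable {p γ : Y → ℝ}

lemma truncated_exp_le (hp : ∀ y, 0 ≤ p y) (hsum : ∑ y, p y = 1) (N : ℕ) (T : ℝ) :
    prodMean (fun _ : Fin N => p) (fun y => (Set.Iic T).indicator Real.exp (∑ n, γ (y n))) ≤
      Real.exp T := by
  have hlaw : IsLaw fun _ : Fin N => p := fun _ => ⟨hp, hsum⟩
  refine (prodMean_mono hlaw fun y => ?_).trans_eq (prodMean_const hlaw _)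
  by_cases h : ∑ n, γ (y n) ≤ T
  · rw [Set.indicator_of_mem (Set.mem_Iic.2 h)]
    exact Real.exp_le_exp.2 h
  · rw [Set.indicator_of_notMem (by simpa using h)]
    exact (Real.exp_pos _).le

/-- Refined bound on the truncated exponential moment, with the `1 / √N` gain. -/
lemma sqrt_mul_truncated_exp_le (hp : ∀ y, 0 ≤ p y) (hsum : ∑ y, p y = 1) {B : ℝ}
    (hγ : ∀ y, |γ y| ≤ B) {u : ℝ} (hu : 0 < u)
    (hvar : ∀ c, u ≤ ∑ y, p y * (γ y - c) ^ 2) {N : ℕ} (hN : 0 < N) (T : ℝ) :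
    √(N * u) * prodMean (fun _ : Fin N => p)
      (fun y => (Set.Iic T).indicator Real.exp (∑ n, γ (y n))) ≤ Real.exp (T + 8 * B) := by
  have hN' : (0 : ℝ) < N := Nat.cast_pos.2 hN
  set μ := ∑ y, p y * γ y with hμ
  have hμB : |μ| ≤ B := by
    calc |μ| ≤ ∑ y, p y * B := by
          refine (Finset.abs_sum_le_sum_abs _ _).trans (Finset.sum_le_sum fun y _ => ?_)
          rw [abs_mul, abs_of_nonneg (hp y)]
          exact mul_le_mul_of_nonneg_left (hγ y) (hp y)
      _ = B := by rw [← Finset.sum_mul, hsum, one_mul]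
  have H : CentredSum (fun _ : Fin N => p) (fun _ y => γ y - μ) (2 * B) := by
    refine ⟨fun _ => ⟨hp, hsum⟩, fun _ => ?_, fun _ y => ?_⟩
    · simp only [mul_sub, Finset.sum_sub_distrib, ← Finset.sum_mul, hsum, one_mul]
      rw [← hμ, sub_self]
    · have := abs_sub (γ y) μ
      linarith [hγ y]
  set s := ∑ y, p y * (γ y - μ) ^ 2 with hs
  have hus : u ≤ s := hvar μ
  have hsv : sumVar (fun _ : Fin N => p) (fun _ y => γ y - μ) = √(N * s) ^ 2 := by
    rw [Real.sq_sqrt (by have := hu.le.trans hus; positivity)]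
    simp [sumVar, hs]
  have h := H.mean_exp_le (Real.sqrt_pos.2 (mul_pos hN' (hu.trans_le hus))) hsv (T - N * μ)
  have hmean : prodMean (fun _ : Fin N => p)
      (fun y => (Set.Iic T).indicator Real.exp (∑ n, γ (y n))) =
      Real.exp (N * μ) * prodMean (fun _ : Fin N => p)
      (fun y => (Set.Iic (T - N * μ)).indicator Real.exp (∑ n, (γ (y n) - μ))) := by
    rw [← prodMean_mul_left]
    congr 1
    ext y
    have : ∑ n, (γ (y n) - μ) = ∑ n, γ (y n) - N * μ := by
      rw [Finset.sum_sub_distrib]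
      simp
    rw [this]
    by_cases h : ∑ n, γ (y n) ≤ T
    · rw [Set.indicator_of_mem (Set.mem_Iic.2 h), Set.indicator_of_mem
        (Set.mem_Iic.2 (sub_le_sub_right h _)), ← Real.exp_add]
      congr 1
      ring
    · rw [Set.indicator_of_notMem (by simpa using h), Set.indicator_of_notMem
        (by simpa using h), mul_zero]
  set E := prodMean (fun _ : Fin N => p)
      (fun y => (Set.Iic (T - N * μ)).indicator Real.exp (∑ n, (γ (y n) - μ))) with hE
  have hE0 : 0 ≤ E := Finset.sum_nonneg fun y _ =>
    mul_nonneg (Finset.prod_nonneg fun n _ => hp _)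
      (Set.indicator_nonneg (fun t _ => (Real.exp_pos t).le) _)
  rw [hmean]
  calc √(N * u) * (Real.exp (N * μ) * E) ≤ √(N * s) * (Real.exp (N * μ) * E) := by gcongr
    _ = Real.exp (N * μ) * (√(N * s) * E) := by ring
    _ ≤ Real.exp (N * μ) * Real.exp (T - N * μ + 4 * (2 * B)) := by gcongr
    _ = Real.exp (T + 8 * B) := by
      rw [← Real.exp_add]
      congr 1
      ring

end OutputLaw

/-! ### The uniform converse -/

section Converse

variable {W : X → Y → ℝ} {P : X → ℝ} {C V B L s D : ℝ} {p γ : Y → ℝ} {N M : ℕ}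
  {f : Fin M → Fin N → X} {φ : (Fin N → Y) → Fin M} {ε : ℝ}

lemma Tilting.log_le_of_bound (H : Tilting W C V B L P p γ s D) (hW : IsDMC W) (hM : 0 < M)
    (hε : ε < 1) (herr : avgErrorProb W f φ ≤ ε) :
    Real.log M ≤ N * B - Real.log (1 - ε) := by
  have h := converse_of_dominated hW H.dom hM (α := 0) (T := N * B) herr (fun m => ?_)
    (truncated_exp_le H.nonneg H.sum_eq N _)
  · rw [sub_zero] at h
    exact log_le_of_mul_le (Nat.cast_pos.2 hM) (by linarith) h
  · refine le_of_eq (Finset.sum_eq_zero fun y _ => ?_)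
    dsimp only
    rw [Set.indicator_of_notMem, mul_zero]
    rw [Set.mem_Ioi, not_lt]
    calc ∑ n, γ (y n) ≤ ∑ _n : Fin N, B :=
          Finset.sum_le_sum fun n _ => (le_abs_self _).trans (H.bound _)
      _ = N * B := by simp

lemma Tilting.log_le_of_chebyshev (H : Tilting W C V B L P p γ s D) (hW : IsDMC W)
    (hP : IsProbDist P) (hc : ∀ m (F : X → ℝ), ∑ n, F (f m n) = N * ∑ x, P x * F x)
    (hN : 0 < N) (hM : 0 < M) (hε : ε < 1) (herr : avgErrorProb W f φ ≤ ε) {κ : ℝ} (hκ : 0 < κ)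
    (hκε : (2 * B) ^ 2 / κ ^ 2 ≤ (1 - ε) / 2) :
    Real.log M ≤ N * (C - D - s ^ 2 / 4) + κ * √N - Real.log ((1 - ε) / 2) := by
  have h := converse_of_dominated hW H.dom hM herr
    (fun m => (chebyshev_codeword hW hP H.bound (hc m) hN hκ).trans hκε)
    (truncated_exp_le H.nonneg H.sum_eq N _)
  rw [show 1 - ε - (1 - ε) / 2 = (1 - ε) / 2 by ring] at h
  have h1 := log_le_of_mul_le (Nat.cast_pos.2 hM) (by linarith) h
  have h2 := mul_le_mul_of_nonneg_left H.mean_le (Nat.cast_nonneg (α := ℝ) N)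
  linarith

lemma Tilting.log_le_of_berry_esseen (H : Tilting W C V B L P p γ s D) (hW : IsDMC W)
    (hB : 0 < B) (hc : ∀ m (F : X → ℝ), ∑ n, F (f m n) = N * ∑ x, P x * F x)
    (hN : 0 < N) (hM : 0 < M) (herr : avgErrorProb W f φ ≤ ε) (hv : 0 < condVar W P γ) {z : ℝ}
    (hz : ε + (2 * √(2 * π) + 9) * (2 * B / √(N * condVar W P γ)) + 1 / √N ≤ stdGaussCDF z) :
    Real.log M ≤ N * (C - D - s ^ 2 / 4) + √(N * condVar W P γ) * z + 10 * B -
      Real.log √(condVar W P γ / 2) := by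
  have hN' : (0 : ℝ) < N := Nat.cast_pos.2 hN
  have hM' : (0 : ℝ) < M := Nat.cast_pos.2 hM
  have hs0 : 0 < √(N : ℝ) := Real.sqrt_pos.2 hN'
  set v := condVar W P γ
  set T := N * ∑ x, P x * condMean W γ x + (√(N * v) * z + 2 * B) with hT
  have h := converse_of_dominated hW H.dom hM herr
    (fun m => berry_esseen_codeword hW H.bound hB (hc m) hN hv z) le_rfl
  rw [← hT] at h
  have h1 : M * (1 / √N) ≤ prodMean (fun _ : Fin N => p)
      (fun y => (Set.Iic T).indicator Real.exp (∑ n, γ (y n))) :=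
    (mul_le_mul_of_nonneg_left (by linarith) hM'.le).trans h
  have h2 := sqrt_mul_truncated_exp_le H.nonneg H.sum_eq H.bound (half_pos hv)
    (fun c => by linarith [H.var_le c]) hN T
  have h3 : M * √(v / 2) ≤ Real.exp (T + 8 * B) := by
    refine le_trans (le_of_eq ?_) ((mul_le_mul_of_nonneg_left h1 (Real.sqrt_nonneg _)).trans h2)
    rw [Real.sqrt_mul hN'.le]
    field_simp
  have h4 := log_le_of_mul_le hM' (Real.sqrt_pos.2 (half_pos hv)) h3
  have h5 := mul_le_mul_of_nonneg_left H.mean_le hN'.le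
  linarith

end Converse

lemma sqrt_le_sqrt_add_div {u v : ℝ} (hv : 0 < v) : √u ≤ √v + |u - v| / √v := by
  have hs : 0 < √v := Real.sqrt_pos.2 hv
  rw [← sub_le_iff_le_add', le_div_iff₀ hs]
  rcases le_total u v with h | h
  · have := Real.sqrt_le_sqrt h
    exact (mul_nonpos_of_nonpos_of_nonneg (by linarith) hs.le).trans (abs_nonneg _)
  · have h1 := Real.sqrt_le_sqrt h
    have h2 := Real.sq_sqrt hv.le
    have h3 := Real.sq_sqrt (hv.le.trans h)
    refine le_trans ?_ (le_abs_self _)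
    nlinarith

/-- Second-order converse for constant composition codes, with the dispersion of the optimal
output law. -/
lemma SingularOpt.exists_log_le [DecidableEq X] {W : X → Y → ℝ} {a q : Y → ℝ} {C : ℝ}
    (H : SingularOpt W a q C) {V : ℝ} (hVdef : ∑ y, q y * (Real.log (a y / q y) - C) ^ 2 = V)
    (hV : 0 < V) {ε : ℝ} (hε0 : 1 / 2 < ε) (hε1 : ε < 1) :
    ∃ K : ℝ, 0 < K ∧ ∀ N : ℕ, 0 < N → ∀ M : ℕ, 0 < M →
      ∀ (f : Fin M → Fin N → X) (φ : (Fin N → Y) → Fin M),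
        ConstComp f → avgErrorProb W f φ ≤ ε →
          Real.log M ≤ N * C + √(N * V) * stdGaussInvCDF ε + K := by
  obtain ⟨B, L, hB, hL, hCB, htilt⟩ := H.exists_tilting
  rw [hVdef] at htilt
  have hW := H.dmc
  obtain ⟨hz0, hzε⟩ := le_stdGaussCDF_stdGaussInvCDF hε0 hε1
  set z := stdGaussInvCDF ε
  have hsV : 0 < √V := Real.sqrt_pos.2 hV
  have hsV2 : 0 < √(V / 2) := Real.sqrt_pos.2 (half_pos hV)
  set d := (√(2 * π))⁻¹ * Real.exp (-(z + 1) ^ 2 / 2) with hd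
  have hd0 : 0 < d := by positivity
  set κ := ((2 * √(2 * π) + 9) * (2 * B / √(V / 2)) + 1) / d with hκ
  have hκ0 : 0 < κ := by positivity
  set k := L * z / √V with hk
  have hk0 : 0 ≤ k := by positivity
  set κ' := √((2 * B) ^ 2 / ((1 - ε) / 2)) with hκ'
  have hε2 : 0 < (1 - ε) / 2 := by linarith
  have hκ'0 : 0 < κ' := Real.sqrt_pos.2 (by positivity)
  have hκ'ε : (2 * B) ^ 2 / κ' ^ 2 ≤ (1 - ε) / 2 := by
    rw [hκ', Real.sq_sqrt (by positivity)]
    refine le_of_eq ?_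
    field_simp
  obtain ⟨c, hc0, hc⟩ : ∃ c : ℝ, 0 < c ∧ ∀ s D : ℝ, 0 ≤ s → 0 ≤ D → V / 2 < L * (s + D) →
      c ≤ D + s ^ 2 / 4 := by
    refine ⟨min (V / (4 * L)) ((V / (4 * L)) ^ 2 / 4), by positivity, fun s D hs hD h => ?_⟩
    have h1 : 0 < V / (4 * L) := by positivity
    have h2 : L * (2 * (V / (4 * L))) = V / 2 := by field_simp; ring
    have h3 : 2 * (V / (4 * L)) < s + D := lt_of_mul_lt_mul_left (h2.trans_lt h) hL.le
    rcases le_or_gt (V / (4 * L)) D with h4 | h4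
    · exact (min_le_left _ _).trans (by nlinarith)
    · exact (min_le_right _ _).trans (by nlinarith)
  set n₀ := κ + k with hn₀
  set K₁ := 2 * B * n₀ ^ 2 - Real.log (1 - ε)
  set K₂ := κ' ^ 2 / (4 * c) - Real.log ((1 - ε) / 2)
  set K₃ := k ^ 2 + 2 * B * κ + 10 * B - Real.log √(V / 4)
  refine ⟨|K₁| + |K₂| + |K₃| + 1, by positivity, fun N hN M hM f φ hf herr => ?_⟩
  have hN' : (0 : ℝ) < N := Nat.cast_pos.2 hN
  have hs0 : 0 < √(N : ℝ) := Real.sqrt_pos.2 hN'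
  have hsN : √(N : ℝ) ^ 2 = N := Real.sq_sqrt hN'.le
  have hmain : 0 ≤ √(N * V) * z := by positivity
  have hK₁ := le_abs_self K₁
  have hK₂ := le_abs_self K₂
  have hK₃ := le_abs_self K₃
  have hK₁' := abs_nonneg K₁
  have hK₂' := abs_nonneg K₂
  have hK₃' := abs_nonneg K₃
  obtain ⟨P, hP, hcode⟩ := hf.exists_type hN hM
  obtain ⟨p, γ, s, D, Ht⟩ := htilt P hP
  rcases lt_or_ge √(N : ℝ) n₀ with hsmall | hlarge
  · have h := Ht.log_le_of_bound (f := f) (φ := φ) hW hM hε1 herr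
    have h1 : (N : ℝ) ≤ n₀ ^ 2 := hsN ▸ pow_le_pow_left₀ hs0.le hsmall.le 2
    have h2 : -B ≤ C := (abs_le.1 hCB).1
    have h3 : N * (B - C) ≤ n₀ ^ 2 * (2 * B) :=
      mul_le_mul h1 (by linarith) (by linarith [(abs_le.1 hCB).2]) (by positivity)
    have h4 : Real.log M ≤ N * C + K₁ := by
      simp only [K₁]
      linarith
    linarith
  rcases lt_or_ge (V / 2) |condVar W P γ - V| with hfar | hnear
  · have h := Ht.log_le_of_chebyshev hW hP hcode hN hM hε1 herr hκ'0 hκ'ε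
    have h1 := hc s D Ht.dist_nonneg Ht.gap_nonneg (hfar.trans_le Ht.var_near)
    have h2 : κ' * √N - N * c ≤ κ' ^ 2 / (4 * c) := by
      rw [le_div_iff₀ (by positivity)]
      nth_rewrite 2 [← hsN]
      linarith [sq_nonneg (κ' - 2 * c * √(N : ℝ))]
    have h3 : N * c ≤ N * (D + s ^ 2 / 4) := by gcongr
    have h4 : Real.log M ≤ N * C + K₂ := by
      simp only [K₂]
      linarith
    linarith
  · set v := condVar W P γ with hvdef
    have hv2 : V / 2 ≤ v := by linarith [(abs_le.1 hnear).1]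
    have hv0 : 0 < v := by linarith
    have hκN : κ ≤ √(N : ℝ) := by linarith
    have hkN : k ≤ √(N : ℝ) := by linarith
    have hz : ε + (2 * √(2 * π) + 9) * (2 * B / √(N * v)) + 1 / √N ≤
        stdGaussCDF (z + κ / √N) := by
      refine le_trans ?_ (stdGaussCDF_add_ge hz0 (by positivity) ((div_le_one hs0).2 hκN))
      have h1 : κ / √N * d = (2 * √(2 * π) + 9) * (2 * B / √(V / 2)) / √N + 1 / √N := by
        rw [hκ]
        field_simp
      have h2 : 2 * B / √(N * v) ≤ 2 * B / √(V / 2) / √N := by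
        rw [div_div, mul_comm √(V / 2), ← Real.sqrt_mul hN'.le]
        gcongr
      have h3 : (2 * √(2 * π) + 9) * (2 * B / √(N * v)) ≤
          (2 * √(2 * π) + 9) * (2 * B / √(V / 2)) / √N :=
        (mul_le_mul_of_nonneg_left h2 (by positivity)).trans_eq (mul_div_assoc _ _ _).symm
      rw [← hd, h1]
      linarith
    have h := Ht.log_le_of_berry_esseen hW hB hcode hN hM herr hv0 hz
    have h1 : √(N * v) * (z + κ / √N) = √N * (√v * z) + √v * κ := by
      rw [Real.sqrt_mul hN'.le]
      field_simp
    have h2 : √v * κ ≤ 2 * B * κ :=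
      mul_le_mul_of_nonneg_right ((Real.sqrt_le_left (by positivity)).2
        (condVar_le_sq hW hP Ht.bound)) hκ0.le
    have h3 : √v * z ≤ √V * z + k * (s + D) := by
      have h4 := (sqrt_le_sqrt_add_div (u := v) hV).trans
        (add_le_add_right (div_le_div_of_nonneg_right Ht.var_near hsV.le) _)
      refine (mul_le_mul_of_nonneg_right h4 hz0).trans_eq ?_
      rw [hk]
      ring
    have h4 : √N * (√v * z) ≤ √(N * V) * z + √N * (k * (s + D)) := by
      rw [Real.sqrt_mul hN'.le, mul_assoc, ← mul_add]
      exact mul_le_mul_of_nonneg_left h3 hs0.le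
    have h5 : √N * (k * s) - N * (s ^ 2 / 4) ≤ k ^ 2 := by
      nth_rewrite 2 [← hsN]
      linarith [sq_nonneg (√(N : ℝ) * s / 2 - k)]
    have h6 : √N * (k * D) ≤ N * D := by
      rw [← mul_assoc]
      refine mul_le_mul_of_nonneg_right ?_ Ht.gap_nonneg
      calc √N * k ≤ √N * √N := mul_le_mul_of_nonneg_left hkN hs0.le
        _ = N := by rw [← sq, hsN]
    have h7 : Real.log √(V / 4) ≤ Real.log √(v / 2) :=
      Real.log_le_log (Real.sqrt_pos.2 (by positivity)) (Real.sqrt_le_sqrt (by linarith))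
    have h8 : Real.log M ≤ N * C + √(N * V) * z + K₃ := by
      rw [h1] at h
      simp only [K₃]
      linarith
    linarith

/-- **Theorem 4(ii)**: for a singular and asymmetric DMC and `ε ∈ (1/2,1)` with `V_ε(W) > 0`,
there is a constant `K̂(ε,W) > 0` such that for every blocklength `N ≥ 1`, every constant
composition code with `M` messages and average error probability at most `ε` satisfies
`ln M ≤ N·C(W) + √(N·V_ε(W))·Φ⁻¹(ε) + K̂(ε,W)`. -/
theorem statement6 {X Y : Type} [Fintype X] [Fintype Y] [DecidableEq X]
    [Nonempty X] [Nonempty Y]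
    (W : X → Y → ℝ) (hW : IsDMC W) (hasym : ¬ GallagerSymmetric W) (hsing : Singular W)
    (ε : ℝ) (hε0 : 1 / 2 < ε) (hε1 : ε < 1) (hV : 0 < Veps W ε) :
    ∃ K : ℝ, 0 < K ∧ ∀ N : ℕ, 0 < N → ∀ (R : ℝ),
      ∀ (f : Fin (Mof N R) → Fin N → X) (φ : (Fin N → Y) → Fin (Mof N R)),
        ConstComp f → avgErrorProb W f φ ≤ ε →
          Real.log (Mof N R) ≤
            N * capacity W + Real.sqrt (N * Veps W ε) * stdGaussInvCDF ε + K := by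
  obtain ⟨a, q, H, hpos, hle⟩ := exists_singularOpt hW hsing hε0 hV
  obtain ⟨K, hK, h⟩ := H.exists_log_le rfl hpos hε0 hε1
  refine ⟨K, hK, fun N hN R f φ hf herr => (h N hN _ ?_ f φ hf herr).trans ?_⟩
  · exact Nat.ceil_pos.2 (Real.exp_pos _)
  · have hz := (le_stdGaussCDF_stdGaussInvCDF hε0 hε1).1
    gcongr
end

section
/- Let W be a symmetric discrete memoryless channel with R_cr < C(W), and let R be any rate with R_∞ < R < C(W). Then E_SP(R) = E_SP(R, U_X) = Ẽ_SP(R, U_X) = Ẽ_SP(R), where U_X is the uniform distribution on the input alphabet X. -/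
open Real Finset

variable {X Y : Type} [Fintype X] [Fintype Y]

open scoped ENNReal
/-- Conditional Kullback–Leibler divergence `D(V ∥ W | Q)`, valued in `ℝ≥0∞`
(it is infinite when `V` is not absolutely continuous w.r.t. `W` on the support of `Q`). -/
noncomputable def condKL (Q : X → ℝ) (V W : X → Y → ℝ) : ℝ≥0∞ :=
  if ∀ x y, 0 < Q x → 0 < V x y → 0 < W x y then
    ENNReal.ofReal (∑ x, ∑ y, Q x * (V x y * Real.log (V x y / W x y)))
  else ⊤

/-- The sphere-packing exponent at input distribution `Q`:
`E_SP(R, Q) = inf { D(V∥W|Q) : V a channel with I(Q;V) ≤ R }`. -/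
noncomputable def ESPQ (W : X → Y → ℝ) (R : ℝ) (Q : X → ℝ) : ℝ≥0∞ :=
  ⨅ V ∈ {V : X → Y → ℝ | IsDMC V ∧ mutualInfo V Q ≤ R}, condKL Q V W

/-- The sphere-packing exponent `E_SP(R) = max_Q E_SP(R, Q)`. -/
noncomputable def ESPKL (W : X → Y → ℝ) (R : ℝ) : ℝ≥0∞ :=
  ⨆ Q ∈ {Q : X → ℝ | IsProbDist Q}, ESPQ W R Q

/-- `Ẽ_SP(R, Q) = sup_{ρ ≥ 0} (E_o(ρ, Q) - ρ R)`. -/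
noncomputable def tESPQ (W : X → Y → ℝ) (R : ℝ) (Q : X → ℝ) : ℝ :=
  sSup {e | ∃ ρ : ℝ, 0 ≤ ρ ∧ e = Eo W Q ρ - ρ * R}

/-- `Ẽ_SP(R) = max_Q Ẽ_SP(R, Q)`. -/
noncomputable def tESP (W : X → Y → ℝ) (R : ℝ) : ℝ :=
  sSup {e | ∃ Q, IsProbDist Q ∧ e = tESPQ W R Q}

/-- `R_∞`: the supremum of rates at which `E_SP(R) = ∞`. -/
noncomputable def RinfKL (W : X → Y → ℝ) : ℝ :=
  sSup {R | ESPKL W R = ⊤}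

/-- The critical rate `R_cr`: the smallest rate above which `E_r = E_SP`. -/
noncomputable def RcrKL (W : X → Y → ℝ) : ℝ :=
  sInf {R | ∀ R', R ≤ R' → ENNReal.ofReal (Er W R') = ESPKL W R'}

/-- The uniform distribution on the input alphabet. -/
noncomputable def unif (X : Type) [Fintype X] : X → ℝ := fun _ => (Fintype.card X : ℝ)⁻¹

lemma sub_le_mul_log_sub_log {p r : ℝ} (hp : 0 ≤ p) (hr : 0 ≤ r) (h : 0 < p → 0 < r) :
    p - r ≤ p * (Real.log p - Real.log r) := by
  rcases hp.eq_or_lt with rfl | hp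
  · simpa using hr
  · have hr := h hp
    have h1 := Real.log_le_sub_one_of_pos (div_pos hr hp)
    rw [Real.log_div hr.ne' hp.ne'] at h1
    have h2 := mul_le_mul_of_nonneg_left h1 hp.le
    have h3 : p * (r / p - 1) = r - p := by field_simp
    nlinarith

/-- The base of the inner power in Gallager's function. -/
noncomputable def tiltMarg (W : X → Y → ℝ) (Q : X → ℝ) (ρ : ℝ) (y : Y) : ℝ :=
  ∑ x, Q x * W x y ^ (1 / (1 + ρ))

/-- The normalising constant `exp (-E_o(ρ, Q))`. -/
noncomputable def tiltNorm (W : X → Y → ℝ) (Q : X → ℝ) (ρ : ℝ) : ℝ :=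
  ∑ y, tiltMarg W Q ρ y ^ (1 + ρ)

/-- The tilted kernel associated with `Q` and `ρ`; it is a channel when the row sums agree. -/
noncomputable def tilt (W : X → Y → ℝ) (Q : X → ℝ) (ρ : ℝ) (x : X) (y : Y) : ℝ :=
  W x y ^ (1 / (1 + ρ)) * tiltMarg W Q ρ y ^ ρ / tiltNorm W Q ρ

lemma Eo_eq_neg_log_tiltNorm (W : X → Y → ℝ) (Q : X → ℝ) (ρ : ℝ) :
    Eo W Q ρ = - Real.log (tiltNorm W Q ρ) := rfl

section Tilt

variable {W : X → Y → ℝ} {Q : X → ℝ} {ρ : ℝ}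

lemma IsProbDist.exists_pos (hQ : IsProbDist Q) : ∃ x, 0 < Q x := by
  by_contra! h
  have : ∑ x, Q x ≤ 0 := Finset.sum_nonpos fun x _ => h x
  linarith [hQ.2]

lemma tiltMarg_nonneg (hW : IsDMC W) (hQ : IsProbDist Q) (y : Y) : 0 ≤ tiltMarg W Q ρ y :=
  Finset.sum_nonneg fun x _ => mul_nonneg (hQ.1 x) (Real.rpow_nonneg (hW.1 x y) _)

lemma tiltMarg_pos (hW : IsDMC W) (hQ : IsProbDist Q) {x : X} {y : Y}
    (hx : 0 < Q x) (hxy : 0 < W x y) : 0 < tiltMarg W Q ρ y :=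
  Finset.sum_pos' (fun x _ => mul_nonneg (hQ.1 x) (Real.rpow_nonneg (hW.1 x y) _))
    ⟨x, Finset.mem_univ _, mul_pos hx (Real.rpow_pos_of_pos hxy _)⟩

lemma tiltNorm_pos (hW : IsDMC W) (hQ : IsProbDist Q) : 0 < tiltNorm W Q ρ := by
  obtain ⟨x, hx⟩ := hQ.exists_pos
  obtain ⟨y, hy⟩ := IsProbDist.exists_pos ⟨hW.1 x, hW.2 x⟩
  exact Finset.sum_pos' (fun y _ => Real.rpow_nonneg (tiltMarg_nonneg hW hQ y) _)
    ⟨y, Finset.mem_univ _, Real.rpow_pos_of_pos (tiltMarg_pos hW hQ hx hy) _⟩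

lemma tiltMarg_mul_rpow (hW : IsDMC W) (hQ : IsProbDist Q) (hρ : 0 ≤ ρ) (y : Y) :
    tiltMarg W Q ρ y * tiltMarg W Q ρ y ^ ρ = tiltMarg W Q ρ y ^ (1 + ρ) := by
  rw [Real.rpow_add' (tiltMarg_nonneg hW hQ y) (by positivity), Real.rpow_one]

lemma tilt_nonneg (hW : IsDMC W) (hQ : IsProbDist Q) (x : X) (y : Y) : 0 ≤ tilt W Q ρ x y :=
  div_nonneg (mul_nonneg (Real.rpow_nonneg (hW.1 x y) _)
    (Real.rpow_nonneg (tiltMarg_nonneg hW hQ y) _)) (tiltNorm_pos hW hQ).le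

lemma tilt_eq_zero (hρ : 0 ≤ ρ) {x : X} {y : Y} (h : W x y = 0) : tilt W Q ρ x y = 0 := by
  have : (1 + ρ)⁻¹ ≠ 0 := by positivity
  simp [tilt, h, Real.zero_rpow this]

lemma tilt_pos (hW : IsDMC W) (hQ : IsProbDist Q) {x : X} {y : Y}
    (hx : 0 < Q x) (hxy : 0 < W x y) : 0 < tilt W Q ρ x y :=
  div_pos (mul_pos (Real.rpow_pos_of_pos hxy _)
    (Real.rpow_pos_of_pos (tiltMarg_pos hW hQ hx hxy) _)) (tiltNorm_pos hW hQ)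

lemma pos_of_tilt_pos (hW : IsDMC W) (hρ : 0 ≤ ρ) {x : X} {y : Y}
    (h : 0 < tilt W Q ρ x y) : 0 < W x y :=
  (hW.1 x y).lt_of_ne fun h0 => h.ne' (tilt_eq_zero hρ h0.symm)

lemma sum_mul_tilt (hW : IsDMC W) (hQ : IsProbDist Q) (hρ : 0 ≤ ρ) (y : Y) :
    ∑ x, Q x * tilt W Q ρ x y = tiltMarg W Q ρ y ^ (1 + ρ) / tiltNorm W Q ρ := by
  rw [← tiltMarg_mul_rpow hW hQ hρ y, tiltMarg.eq_def W Q ρ y, Finset.sum_mul, Finset.sum_div]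
  refine Finset.sum_congr rfl fun x _ => ?_
  rw [tilt, tiltMarg, mul_div_assoc, mul_div_assoc, mul_assoc]

lemma sum_sum_mul_tilt (hW : IsDMC W) (hQ : IsProbDist Q) (hρ : 0 ≤ ρ) :
    ∑ x, ∑ y, Q x * tilt W Q ρ x y = 1 := by
  rw [Finset.sum_comm]
  simp_rw [sum_mul_tilt hW hQ hρ]
  rw [← Finset.sum_div]
  exact div_self (tiltNorm_pos hW hQ).ne'

lemma tilt_zero (hW : IsDMC W) (hQ : IsProbDist Q) : tilt W Q 0 = W := by
  have hZ : tiltNorm W Q 0 = 1 := by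
    simp only [tiltNorm, tiltMarg, add_zero, div_one, Real.rpow_one]
    rw [Finset.sum_comm]
    simp_rw [← Finset.mul_sum, hW.2, mul_one, hQ.2]
  funext x y
  simp [tilt, hZ]

lemma sum_sum_mul_channel {V : X → Y → ℝ} (hV : IsDMC V) (hQ : IsProbDist Q) :
    ∑ x, ∑ y, Q x * V x y = 1 := by
  simp_rw [← Finset.mul_sum, hV.2, mul_one, hQ.2]

lemma marg_nonneg {V : X → Y → ℝ} (hV : IsDMC V) (hQ : IsProbDist Q) (y : Y) :
    0 ≤ ∑ z, Q z * V z y :=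
  Finset.sum_nonneg fun z _ => mul_nonneg (hQ.1 z) (hV.1 z y)

lemma marg_pos {V : X → Y → ℝ} (hV : IsDMC V) (hQ : IsProbDist Q) {x : X} {y : Y}
    (hx : 0 < Q x) (hxy : 0 < V x y) : 0 < ∑ z, Q z * V z y :=
  Finset.sum_pos' (fun z _ => mul_nonneg (hQ.1 z) (hV.1 z y))
    ⟨x, Finset.mem_univ _, mul_pos hx hxy⟩

lemma mul_log_tilt (hρ : 0 ≤ ρ) {P v w q a Z : ℝ} :
    P * (Real.log v - 1 / (1 + ρ) * Real.log w - ρ * Real.log a + Real.log Z)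
      + ρ * (P * (Real.log v - 1 / (1 + ρ) * Real.log w - Real.log q + Real.log a))
    = P * (Real.log v - Real.log w) + ρ * (P * (Real.log v - Real.log q)) + P * Real.log Z := by
  have : 1 + ρ ≠ 0 := by positivity
  field_simp
  ring

/-- The sphere-packing lower bound: `E_o(ρ, Q) ≤ D(V ∥ W | Q) + ρ I(Q; V)`. -/
lemma Eo_le_div_add_mutualInfo {V : X → Y → ℝ} (hW : IsDMC W) (hV : IsDMC V)
    (hQ : IsProbDist Q) (hac : ∀ x y, 0 < Q x → 0 < V x y → 0 < W x y) (hρ : 0 ≤ ρ) :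
    Eo W Q ρ ≤ ∑ x, ∑ y, Q x * (V x y * Real.log (V x y / W x y)) + ρ * mutualInfo V Q := by
  set q : Y → ℝ := fun y => ∑ z, Q z * V z y with hq
  set a := tiltMarg W Q ρ with ha
  set Z := tiltNorm W Q ρ with hZ
  have hZ0 : 0 < Z := tiltNorm_pos hW hQ
  have ha0 : ∀ y, 0 ≤ a y := fun y => tiltMarg_nonneg hW hQ y
  have hq0 : ∀ y, 0 ≤ q y := fun y => marg_nonneg hV hQ y
  have hpt : ∀ x y, (Q x * V x y - Q x * tilt W Q ρ x y)
      + ρ * (Q x * V x y - Q x * W x y ^ (1 / (1 + ρ)) * q y / a y)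
      ≤ Q x * (V x y * Real.log (V x y / W x y))
        + ρ * (Q x * V x y * Real.log (V x y / q y)) + Q x * V x y * Real.log Z := by
    intro x y
    have hr1 : 0 ≤ Q x * tilt W Q ρ x y := mul_nonneg (hQ.1 x) (tilt_nonneg hW hQ x y)
    have hr2 : 0 ≤ Q x * W x y ^ (1 / (1 + ρ)) * q y / a y :=
      div_nonneg (mul_nonneg (mul_nonneg (hQ.1 x) (Real.rpow_nonneg (hW.1 x y) _)) (hq0 y)) (ha0 y)
    rcases (mul_nonneg (hQ.1 x) (hV.1 x y)).eq_or_lt with h0 | h0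
    · rw [← mul_assoc, ← h0]
      simp only [zero_mul, mul_zero, add_zero, zero_sub]
      nlinarith
    · have hQx : 0 < Q x := pos_of_mul_pos_left h0 (hV.1 x y)
      have hVx : 0 < V x y := pos_of_mul_pos_right h0 (hQ.1 x)
      have hWx := hac x y hQx hVx
      have hax : 0 < a y := tiltMarg_pos hW hQ hQx hWx
      have hqx : 0 < q y := marg_pos hV hQ hQx hVx
      have hws : 0 < W x y ^ (1 / (1 + ρ)) := Real.rpow_pos_of_pos hWx _
      have har : 0 < a y ^ ρ := Real.rpow_pos_of_pos hax _
      have h1 := sub_le_mul_log_sub_log h0.le hr1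
        fun _ => mul_pos hQx (tilt_pos hW hQ hQx hWx)
      have h2 := sub_le_mul_log_sub_log h0.le hr2
        fun _ => by positivity
      have e1 : Real.log (Q x * V x y) - Real.log (Q x * tilt W Q ρ x y)
          = Real.log (V x y) - 1 / (1 + ρ) * Real.log (W x y) - ρ * Real.log (a y)
            + Real.log Z := by
        rw [tilt, Real.log_mul hQx.ne' hVx.ne', Real.log_mul hQx.ne' (by positivity),
          Real.log_div (by positivity) hZ0.ne', Real.log_mul hws.ne' har.ne',
          Real.log_rpow hWx, Real.log_rpow hax]
        ring
      have e2 : Real.log (Q x * V x y) - Real.log (Q x * W x y ^ (1 / (1 + ρ)) * q y / a y)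
          = Real.log (V x y) - 1 / (1 + ρ) * Real.log (W x y) - Real.log (q y)
            + Real.log (a y) := by
        rw [Real.log_mul hQx.ne' hVx.ne', Real.log_div (by positivity) hax.ne',
          Real.log_mul (by positivity) hqx.ne', Real.log_mul hQx.ne' hws.ne', Real.log_rpow hWx]
        ring
      rw [e1] at h1
      rw [e2] at h2
      have h3 := add_le_add h1 (mul_le_mul_of_nonneg_left h2 hρ)
      rw [mul_log_tilt hρ] at h3
      rw [Real.log_div hVx.ne' hWx.ne', Real.log_div hVx.ne' hqx.ne', ← mul_assoc]
      exact h3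
  have hsum := Finset.sum_le_sum fun x (_ : x ∈ Finset.univ) =>
    Finset.sum_le_sum fun y (_ : y ∈ Finset.univ) => hpt x y
  simp only [Finset.sum_add_distrib, Finset.sum_sub_distrib, ← Finset.mul_sum,
    ← Finset.sum_mul] at hsum
  have hA : ∑ x, Q x * ∑ y, V x y = 1 := by simp [hV.2, hQ.2]
  have hB : ∑ x, Q x * ∑ y, tilt W Q ρ x y = 1 := by
    simpa only [← Finset.mul_sum] using sum_sum_mul_tilt hW hQ hρ
  have hC : ∑ x, ∑ y, Q x * W x y ^ (1 / (1 + ρ)) * q y / a y ≤ 1 := by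
    have hq1 : ∑ y, q y = 1 := by
      rw [← sum_sum_mul_channel hV hQ, Finset.sum_comm]
    refine le_of_le_of_eq ?_ hq1
    rw [Finset.sum_comm]
    refine Finset.sum_le_sum fun y _ => ?_
    rw [← Finset.sum_div, ← Finset.sum_mul]
    change a y * q y / a y ≤ q y
    rcases (ha0 y).eq_or_lt with h | h
    · simp [← h, hq0 y]
    · rw [mul_div_cancel_left₀ _ h.ne']
  rw [hA, hB] at hsum
  have hI : mutualInfo V Q = ∑ x, ∑ y, Q x * V x y * Real.log (V x y / q y) := rfl
  rw [Eo_eq_neg_log_tiltNorm, hI]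
  simp only [← Finset.mul_sum] at hsum ⊢
  nlinarith [mul_le_mul_of_nonneg_left hC hρ]

/-- Equality in `Eo_le_div_add_mutualInfo` at the tilted channel. -/
lemma Eo_eq_div_add_mutualInfo_tilt (hW : IsDMC W) (hQ : IsProbDist Q) (hρ : 0 ≤ ρ) :
    Eo W Q ρ = ∑ x, ∑ y, Q x * (tilt W Q ρ x y * Real.log (tilt W Q ρ x y / W x y))
      + ρ * mutualInfo (tilt W Q ρ) Q := by
  have hZ0 : 0 < tiltNorm W Q ρ := tiltNorm_pos hW hQ
  have hpt : ∀ x y, Q x * (tilt W Q ρ x y * Real.log (tilt W Q ρ x y / W x y))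
      + ρ * (Q x * tilt W Q ρ x y * Real.log (tilt W Q ρ x y / ∑ z, Q z * tilt W Q ρ z y))
      = Q x * tilt W Q ρ x y * - Real.log (tiltNorm W Q ρ) := by
    intro x y
    rcases (hQ.1 x).eq_or_lt with h | hQx
    · simp [← h]
    rcases (hW.1 x y).eq_or_lt with h | hWx
    · simp [tilt_eq_zero hρ h.symm]
    have hax : 0 < tiltMarg W Q ρ y := tiltMarg_pos hW hQ hQx hWx
    have hws : 0 < W x y ^ (1 / (1 + ρ)) := Real.rpow_pos_of_pos hWx _
    have har : 0 < tiltMarg W Q ρ y ^ ρ := Real.rpow_pos_of_pos hax _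
    have har' : 0 < tiltMarg W Q ρ y ^ (1 + ρ) := Real.rpow_pos_of_pos hax _
    have hT : 0 < tilt W Q ρ x y := tilt_pos hW hQ hQx hWx
    have eT : Real.log (tilt W Q ρ x y) = 1 / (1 + ρ) * Real.log (W x y)
        + ρ * Real.log (tiltMarg W Q ρ y) - Real.log (tiltNorm W Q ρ) := by
      rw [tilt, Real.log_div (by positivity) hZ0.ne', Real.log_mul hws.ne' har.ne',
          Real.log_rpow hWx, Real.log_rpow hax]
    rw [sum_mul_tilt hW hQ hρ, Real.log_div hT.ne' hWx.ne', Real.log_div hT.ne' (by positivity),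
      Real.log_div har'.ne' hZ0.ne', Real.log_rpow hax, eT]
    have : 1 + ρ ≠ 0 := by positivity
    field_simp
    ring
  have hsum := Finset.sum_congr rfl fun x (_ : x ∈ Finset.univ) =>
    Finset.sum_congr rfl fun y (_ : y ∈ Finset.univ) => hpt x y
  have h1 : ∑ x, ∑ y, Q x * tilt W Q ρ x y * - Real.log (tiltNorm W Q ρ)
      = - Real.log (tiltNorm W Q ρ) := by
    simp_rw [← Finset.sum_mul]
    rw [sum_sum_mul_tilt hW hQ hρ, one_mul]
  rw [Eo_eq_neg_log_tiltNorm, ← h1, ← hsum, mutualInfo]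
  simp only [Finset.sum_add_distrib, Finset.mul_sum]

/-- Conditional divergence is nonnegative. -/
lemma sum_sum_mul_log_div_nonneg {V : X → Y → ℝ} (hW : IsDMC W) (hV : IsDMC V)
    (hQ : IsProbDist Q) (hac : ∀ x y, 0 < V x y → 0 < W x y) :
    0 ≤ ∑ x, ∑ y, Q x * (V x y * Real.log (V x y / W x y)) := by
  refine Finset.sum_nonneg fun x _ => ?_
  rw [← Finset.mul_sum]
  refine mul_nonneg (hQ.1 x) ?_
  have h : ∑ y, (V x y - W x y) ≤ ∑ y, V x y * Real.log (V x y / W x y) := by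
    refine Finset.sum_le_sum fun y _ => ?_
    rcases (hV.1 x y).eq_or_lt with h0 | h0
    · simpa [← h0] using hW.1 x y
    · rw [Real.log_div h0.ne' (hac x y h0).ne']
      exact sub_le_mul_log_sub_log h0.le (hW.1 x y) (hac x y)
  rwa [Finset.sum_sub_distrib, hV.2, hW.2, sub_self] at h

/-- Mutual information is at most the divergence from any fixed output distribution. -/
lemma mutualInfo_le {V : X → Y → ℝ} {r : Y → ℝ} (hV : IsDMC V) (hQ : IsProbDist Q)
    (hr : IsProbDist r) (hac : ∀ x y, 0 < V x y → 0 < r y) :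
    mutualInfo V Q ≤ ∑ x, Q x * ∑ y, V x y * Real.log (V x y / r y) := by
  set q : Y → ℝ := fun y => ∑ z, Q z * V z y with hq
  have hq0 : ∀ y, 0 ≤ q y := fun y => marg_nonneg hV hQ y
  have hpt : ∀ x y, Q x * V x y * Real.log (V x y / q y)
      + Q x * V x y * (Real.log (q y) - Real.log (r y))
      = Q x * (V x y * Real.log (V x y / r y)) := by
    intro x y
    rcases (hQ.1 x).eq_or_lt with h | hQx
    · simp [← h]
    rcases (hV.1 x y).eq_or_lt with h | hVx
    · simp [← h]
    rw [Real.log_div hVx.ne' (marg_pos hV hQ hQx hVx).ne', Real.log_div hVx.ne' (hac x y hVx).ne']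
    ring
  have h2 : 0 ≤ ∑ x, ∑ y, Q x * V x y * (Real.log (q y) - Real.log (r y)) := by
    rw [Finset.sum_comm]
    simp_rw [← Finset.sum_mul]
    have hqs : ∑ y, q y = 1 := by
      rw [← sum_sum_mul_channel hV hQ, Finset.sum_comm]
    have : ∑ y, (q y - r y) ≤ ∑ y, q y * (Real.log (q y) - Real.log (r y)) := by
      refine Finset.sum_le_sum fun y _ => sub_le_mul_log_sub_log (hq0 y) (hr.1 y) fun h => ?_
      obtain ⟨x, -, hx⟩ := Finset.exists_lt_of_sum_lt (f := fun _ => (0 : ℝ)) (by simpa using h)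
      exact hac x y (pos_of_mul_pos_right hx (hQ.1 x))
    rwa [Finset.sum_sub_distrib, hqs, hr.2, sub_self] at this
  have h3 : ∑ x, Q x * ∑ y, V x y * Real.log (V x y / r y) = mutualInfo V Q
      + ∑ x, ∑ y, Q x * V x y * (Real.log (q y) - Real.log (r y)) := by
    simp only [mutualInfo, Finset.mul_sum, ← Finset.sum_add_distrib]
    exact Finset.sum_congr rfl fun x _ => Finset.sum_congr rfl fun y _ => (hpt x y).symm
  linarith

lemma continuousOn_tilt (hW : IsDMC W) (hQ : IsProbDist Q) (x : X) (y : Y) (hx : 0 < Q x) :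
    ContinuousOn (fun ρ => tilt W Q ρ x y) (Set.Ici 0) := by
  have hs : ∀ ρ ∈ Set.Ici (0 : ℝ), 0 < 1 / (1 + ρ) := by
    intro ρ hρ
    have : (0 : ℝ) ≤ ρ := hρ
    positivity
  have hsc : ContinuousOn (fun ρ : ℝ => 1 / (1 + ρ)) (Set.Ici 0) :=
    continuousOn_const.div (by fun_prop) fun ρ hρ => by
      have : (0 : ℝ) ≤ ρ := hρ
      positivity
  have hw : ∀ x y, ContinuousOn (fun ρ : ℝ => W x y ^ (1 / (1 + ρ))) (Set.Ici 0) :=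
    fun x y => continuousOn_const.rpow hsc fun ρ hρ => Or.inr (hs ρ hρ)
  have ha : ∀ y, ContinuousOn (fun ρ : ℝ => tiltMarg W Q ρ y) (Set.Ici 0) :=
    fun y => continuousOn_finsetSum _ fun x _ => continuousOn_const.mul (hw x y)
  have hZ : ContinuousOn (fun ρ : ℝ => tiltNorm W Q ρ) (Set.Ici 0) :=
    continuousOn_finsetSum _ fun y _ => (ha y).rpow (by fun_prop) fun ρ hρ => Or.inr (by
      have : (0 : ℝ) ≤ ρ := hρ
      positivity)
  rcases (hW.1 x y).eq_or_lt with h | h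
  · exact continuousOn_const.congr fun ρ hρ => tilt_eq_zero hρ h.symm
  · exact ((hw x y).mul ((ha y).rpow continuousOn_id
      fun ρ _ => Or.inl (tiltMarg_pos hW hQ hx h).ne')).div hZ fun ρ _ => (tiltNorm_pos hW hQ).ne'

lemma continuousOn_mutualInfo_tilt (hW : IsDMC W) (hQ : IsProbDist Q) (hpos : ∀ x, 0 < Q x) :
    ContinuousOn (fun ρ => mutualInfo (tilt W Q ρ) Q) (Set.Ici 0) := by
  refine continuousOn_finsetSum _ fun x _ => continuousOn_finsetSum _ fun y _ => ?_
  rcases (hW.1 x y).eq_or_lt with h | h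
  · refine (continuousOn_const (c := (0 : ℝ))).congr fun ρ hρ => ?_
    simp [tilt_eq_zero hρ h.symm]
  · have hc := fun x y => continuousOn_tilt hW hQ x y (hpos x)
    have hq : ∀ ρ, 0 < ∑ z, Q z * tilt W Q ρ z y := fun ρ =>
      Finset.sum_pos' (fun z _ => mul_nonneg (hQ.1 z) (tilt_nonneg hW hQ z y))
        ⟨x, Finset.mem_univ _, mul_pos (hpos x) (tilt_pos hW hQ (hpos x) h)⟩
    refine (continuousOn_const.mul (hc x y)).mul (ContinuousOn.log ((hc x y).div
      (continuousOn_finsetSum _ fun z _ => continuousOn_const.mul (hc z y))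
      fun ρ _ => (hq ρ).ne') fun ρ _ => ?_)
    exact (div_pos (tilt_pos hW hQ (hpos x) h) (hq ρ)).ne'

end Tilt

lemma ofReal_Eo_sub_le_ESPQ {W : X → Y → ℝ} {Q : X → ℝ} {R ρ : ℝ} (hW : IsDMC W) (hQ : IsProbDist Q)
    (hρ : 0 ≤ ρ) : ENNReal.ofReal (Eo W Q ρ - ρ * R) ≤ ESPQ W R Q := by
  refine le_iInf₂ fun V hV => ?_
  rw [condKL]
  split_ifs with hac
  · refine ENNReal.ofReal_le_ofReal ?_
    have := Eo_le_div_add_mutualInfo hW hV.1 hQ hac hρ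
    have := mul_le_mul_of_nonneg_left hV.2 hρ
    linarith
  · exact le_top

lemma isProbDist_unif (X : Type) [Fintype X] [Nonempty X] : IsProbDist (unif X) :=
  ⟨fun _ => by simp [unif], by simp [unif]⟩

lemma unif_pos {X : Type} [Fintype X] [Nonempty X] (x : X) : 0 < unif X x := by
  simp [unif, Fintype.card_pos]

lemma sum_eq_of_rows_perm {A : Type} {W : A → Y → ℝ} {cls : Y → ℕ}
    (hrow : ∀ (l : ℕ) (x x' : A),
        ((Finset.univ.filter fun y => cls y = l).val.map fun y => W x y) =
        ((Finset.univ.filter fun y => cls y = l).val.map fun y => W x' y))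
    {c : Y → ℝ} (hc : ∀ y y', cls y = cls y' → c y = c y') (f : ℝ → ℝ → ℝ) (x x' : A) :
    ∑ y, f (W x y) (c y) = ∑ y, f (W x' y) (c y) := by
  have hm : ∀ y ∈ (Finset.univ : Finset Y), cls y ∈ Finset.univ.image cls := fun y hy =>
    Finset.mem_image_of_mem _ hy
  rw [← Finset.sum_fiberwise_of_maps_to hm, ← Finset.sum_fiberwise_of_maps_to hm]
  refine Finset.sum_congr rfl fun l hl => ?_
  obtain ⟨y₀, -, rfl⟩ := Finset.mem_image.mp hl
  have hconst : ∀ x, ∑ y ∈ Finset.univ.filter (fun y => cls y = cls y₀), f (W x y) (c y)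
      = (((Finset.univ.filter fun y => cls y = cls y₀).val.map fun y => W x y).map
          fun w => f w (c y₀)).sum := by
    intro x
    rw [Multiset.map_map]
    refine Finset.sum_congr rfl fun y hy => ?_
    rw [hc y y₀ (Finset.mem_filter.mp hy).2]
    rfl
  rw [hconst, hconst, hrow _ x x']

section Symmetric

variable {W : X → Y → ℝ}

lemma GallagerSymmetric.sum_tiltMarg_eq (hsym : GallagerSymmetric W) (ρ : ℝ) (f : ℝ → ℝ → ℝ)
    (x x' : X) : ∑ y, f (W x y) (tiltMarg W (unif X) ρ y)
      = ∑ y, f (W x' y) (tiltMarg W (unif X) ρ y) := by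
  obtain ⟨cls, hrow, hcol⟩ := hsym
  refine sum_eq_of_rows_perm hrow (fun y y' h => ?_) f x x'
  have := congrArg (fun s => (s.map fun w : ℝ =>
    (Fintype.card X : ℝ)⁻¹ * w ^ (1 / (1 + ρ))).sum) (hcol y y' h)
  rw [Multiset.map_map, Multiset.map_map] at this
  exact this

variable [Nonempty X]

lemma sum_unif_mul_of_forall_eq {g : X → ℝ} (hg : ∀ x x', g x = g x') {Q : X → ℝ}
    (hQ : IsProbDist Q) : ∑ x, Q x * g x = ∑ x, unif X x * g x := by
  have x₀ : X := Classical.arbitrary X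
  simp_rw [fun x => hg x x₀, ← Finset.sum_mul, hQ.2, (isProbDist_unif X).2]

lemma isDMC_tilt (hW : IsDMC W) (hsym : GallagerSymmetric W) {ρ : ℝ} (hρ : 0 ≤ ρ) :
    IsDMC (tilt W (unif X) ρ) := by
  refine ⟨fun x y => tilt_nonneg hW (isProbDist_unif X) x y, fun x => ?_⟩
  have h := sum_sum_mul_tilt hW (isProbDist_unif X) hρ
  have hx : ∀ x', ∑ y, tilt W (unif X) ρ x' y = ∑ y, tilt W (unif X) ρ x y := fun x' =>
    hsym.sum_tiltMarg_eq ρ (fun w a => w ^ (1 / (1 + ρ)) * a ^ ρ / tiltNorm W (unif X) ρ) x' x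
  simp_rw [← Finset.mul_sum, hx, ← Finset.sum_mul, (isProbDist_unif X).2, one_mul] at h
  exact h

lemma div_tilt_eq (hsym : GallagerSymmetric W) (ρ : ℝ)
    {Q : X → ℝ} (hQ : IsProbDist Q) :
    ∑ x, ∑ y, Q x * (tilt W (unif X) ρ x y * Real.log (tilt W (unif X) ρ x y / W x y))
      = ∑ x, ∑ y, unif X x *
        (tilt W (unif X) ρ x y * Real.log (tilt W (unif X) ρ x y / W x y)) := by
  simp_rw [← Finset.mul_sum]
  exact sum_unif_mul_of_forall_eq (fun x x' => hsym.sum_tiltMarg_eq ρ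
    (fun w a => w ^ (1 / (1 + ρ)) * a ^ ρ / tiltNorm W (unif X) ρ *
      Real.log (w ^ (1 / (1 + ρ)) * a ^ ρ / tiltNorm W (unif X) ρ / w)) x x') hQ

lemma mutualInfo_tilt_le (hW : IsDMC W) (hsym : GallagerSymmetric W) {ρ : ℝ} (hρ : 0 ≤ ρ)
    {Q : X → ℝ} (hQ : IsProbDist Q) :
    mutualInfo (tilt W (unif X) ρ) Q ≤ mutualInfo (tilt W (unif X) ρ) (unif X) := by
  have hU := isProbDist_unif X
  have hV := isDMC_tilt hW hsym hρ
  have hr : IsProbDist fun y => ∑ z, unif X z * tilt W (unif X) ρ z y :=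
    ⟨marg_nonneg hV hU, by rw [Finset.sum_comm]; exact sum_sum_mul_channel hV hU⟩
  refine (mutualInfo_le hV hQ hr fun x y h => marg_pos hV hU (unif_pos x) h).trans_eq ?_
  have := sum_unif_mul_of_forall_eq (fun x x' => hsym.sum_tiltMarg_eq ρ
    (fun w a => w ^ (1 / (1 + ρ)) * a ^ ρ / tiltNorm W (unif X) ρ *
      Real.log (w ^ (1 / (1 + ρ)) * a ^ ρ / tiltNorm W (unif X) ρ /
        (a ^ (1 + ρ) / tiltNorm W (unif X) ρ))) x x') hQ
  simp_rw [mutualInfo, mul_assoc, ← Finset.mul_sum, sum_mul_tilt hW hU hρ]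
  exact this

lemma mutualInfo_le_unif (hW : IsDMC W) (hsym : GallagerSymmetric W)
    {Q : X → ℝ} (hQ : IsProbDist Q) : mutualInfo W Q ≤ mutualInfo W (unif X) := by
  simpa [tilt_zero hW (isProbDist_unif X)] using mutualInfo_tilt_le hW hsym le_rfl hQ

lemma capacity_le_mutualInfo_unif (hW : IsDMC W) (hsym : GallagerSymmetric W) :
    capacity W ≤ mutualInfo W (unif X) :=
  csSup_le ⟨_, unif X, isProbDist_unif X, rfl⟩ fun _ ⟨_, hQ, h⟩ =>
    h ▸ mutualInfo_le_unif hW hsym hQ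

lemma ESPQ_le_div_tilt (hW : IsDMC W) (hsym : GallagerSymmetric W) {R ρ : ℝ} (hρ : 0 ≤ ρ)
    (hR : mutualInfo (tilt W (unif X) ρ) (unif X) ≤ R) {Q : X → ℝ} (hQ : IsProbDist Q) :
    ESPQ W R Q ≤ ENNReal.ofReal (∑ x, ∑ y, unif X x *
      (tilt W (unif X) ρ x y * Real.log (tilt W (unif X) ρ x y / W x y))) := by
  refine (iInf₂_le _ ⟨isDMC_tilt hW hsym hρ, (mutualInfo_tilt_le hW hsym hρ hQ).trans hR⟩).trans ?_
  rw [condKL, if_pos fun x y _ h => pos_of_tilt_pos hW hρ h, div_tilt_eq hsym ρ hQ]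

lemma bddAbove_ESPKL_eq_top (hW : IsDMC W) (hsym : GallagerSymmetric W) :
    BddAbove {R | ESPKL W R = ⊤} := by
  refine ⟨mutualInfo W (unif X), fun R hR => ?_⟩
  by_contra! h
  have hle : ESPKL W R ≤ _ := iSup₂_le fun Q hQ => ESPQ_le_div_tilt hW hsym le_rfl
    (by rw [tilt_zero hW (isProbDist_unif X)]; exact h.le) hQ
  rw [show ESPKL W R = ⊤ from hR] at hle
  exact ENNReal.ofReal_ne_top (top_le_iff.mp hle)

lemma exists_mutualInfo_tilt_eq (hW : IsDMC W) (hsym : GallagerSymmetric W) {R : ℝ}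
    (hR1 : RinfKL W < R) (hR2 : R < capacity W) :
    ∃ ρ, 0 ≤ ρ ∧ mutualInfo (tilt W (unif X) ρ) (unif X) = R := by
  have hU := isProbDist_unif X
  obtain ⟨R', hR', hlt⟩ := exists_between hR1
  have hfin : ESPKL W R' ≠ ⊤ := fun h =>
    hR'.not_ge (le_csSup (bddAbove_ESPKL_eq_top hW hsym) h)
  set M := (ESPKL W R').toReal with hM
  have hEo : ∀ ρ, 0 ≤ ρ → Eo W (unif X) ρ - ρ * R' ≤ M := fun ρ hρ =>
    (ENNReal.ofReal_le_iff_le_toReal hfin).mp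
      ((ofReal_Eo_sub_le_ESPQ hW hU hρ).trans (le_iSup₂_of_le (unif X) hU le_rfl))
  have hpos : 0 < R - R' := sub_pos.mpr hlt
  set ρ₁ := M / (R - R') with hρ₁
  have hρ0 : 0 ≤ ρ₁ := div_nonneg ENNReal.toReal_nonneg hpos.le
  have hle : ∃ ρ, 0 ≤ ρ ∧ mutualInfo (tilt W (unif X) ρ) (unif X) ≤ R := by
    refine ⟨ρ₁ + 1, by positivity, ?_⟩
    have hρ : 0 ≤ ρ₁ + 1 := by positivity
    have h1 := Eo_eq_div_add_mutualInfo_tilt hW hU hρ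
    have h2 := sum_sum_mul_log_div_nonneg hW (isDMC_tilt hW hsym hρ) hU
      fun x y h => pos_of_tilt_pos hW hρ h
    have h3 := hEo _ hρ
    have h4 : M = ρ₁ * (R - R') := by rw [hρ₁, div_mul_cancel₀ _ hpos.ne']
    refine le_of_mul_le_mul_left ?_ (by positivity : 0 < ρ₁ + 1)
    nlinarith
  obtain ⟨ρ, hρ, hle⟩ := hle
  have hC : R ≤ mutualInfo (tilt W (unif X) 0) (unif X) := by
    rw [tilt_zero hW hU]
    exact hR2.le.trans (capacity_le_mutualInfo_unif hW hsym)
  obtain ⟨ρ', hρ', h⟩ := intermediate_value_Icc' hρ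
    ((continuousOn_mutualInfo_tilt hW hU unif_pos).mono Set.Icc_subset_Ici_self) ⟨hle, hC⟩
  exact ⟨ρ', hρ'.1, h⟩

end Symmetric

/-- **Proposition 1(i)**: for a symmetric channel with `R_cr < C(W)` and `R_∞ < R < C(W)`,
`E_SP(R) = E_SP(R, U_X) = Ẽ_SP(R, U_X) = Ẽ_SP(R)`. -/
theorem statement7 {X Y : Type} [Fintype X] [Fintype Y] [Nonempty X] [Nonempty Y]
    (W : X → Y → ℝ) (hW : IsDMC W) (hsym : GallagerSymmetric W)
    (hcr : RcrKL W < capacity W)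
    (R : ℝ) (hR1 : RinfKL W < R) (hR2 : R < capacity W) :
    ESPKL W R = ESPQ W R (unif X) ∧
    ESPQ W R (unif X) = ENNReal.ofReal (tESPQ W R (unif X)) ∧
    tESPQ W R (unif X) = tESP W R := by
  have hU := isProbDist_unif X
  obtain ⟨ρ, hρ, hI⟩ := exists_mutualInfo_tilt_eq hW hsym hR1 hR2
  have hup := fun Q (hQ : IsProbDist Q) => ESPQ_le_div_tilt hW hsym hρ hI.le hQ
  have hD0 := sum_sum_mul_log_div_nonneg hW (isDMC_tilt hW hsym hρ) hU
    fun x y h => pos_of_tilt_pos hW hρ h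
  have hD := Eo_eq_div_add_mutualInfo_tilt hW hU hρ
  rw [hI] at hD
  set D := ∑ x, ∑ y, unif X x *
    (tilt W (unif X) ρ x y * Real.log (tilt W (unif X) ρ x y / W x y)) with hDdef
  have hlow : ∀ Q, IsProbDist Q → ∀ ρ', 0 ≤ ρ' → Eo W Q ρ' - ρ' * R ≤ D := fun Q hQ ρ' hρ' =>
    (ENNReal.ofReal_le_ofReal_iff hD0).mp ((ofReal_Eo_sub_le_ESPQ hW hQ hρ').trans (hup Q hQ))
  have ht : tESPQ W R (unif X) = D :=
    IsGreatest.csSup_eq ⟨⟨ρ, hρ, by linarith⟩, fun e ⟨ρ', hρ', he⟩ => he ▸ hlow _ hU ρ' hρ'⟩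
  have hE : ESPQ W R (unif X) = ENNReal.ofReal D := by
    refine le_antisymm (hup _ hU) ?_
    have := ofReal_Eo_sub_le_ESPQ (R := R) hW hU hρ
    rwa [hD, add_sub_cancel_right] at this
  refine ⟨?_, by rw [hE, ht], ?_⟩
  · exact le_antisymm (iSup₂_le fun Q hQ => hE ▸ hup Q hQ) (le_iSup₂_of_le (unif X) hU le_rfl)
  · rw [ht]
    refine Eq.symm (IsGreatest.csSup_eq ⟨⟨unif X, hU, ht.symm⟩, ?_⟩)
    rintro e ⟨Q, hQ, rfl⟩
    exact csSup_le ⟨Eo W Q 0 - 0 * R, 0, le_rfl, rfl⟩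
      fun e ⟨ρ', hρ', he⟩ => he ▸ hlow Q hQ ρ' hρ'
end
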